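/- Let g be the Kac-Moody algebra of an indecomposable symmetrizable generalized Cartan matrix A and (I,J) a C-admissible pair, with sl₂-triples (E_k,H_k,F_k) for k∈I' = I∖J. Let g^J be the subalgebra of g generated by h^J and the elements E_k, F_k (k∈I'). Then g^J is the Kac-Moody algebra associated to the realization (h^J, Π^J, Π^{J∨}) of the generalized Cartan matrix A^J; in particular the Serre relations (ad E_k)^{1−a'_{k,l}}(E_l)=0 and (ad F_k)^{1−a'_{k,l}}(F_l)=0 hold for k≠l in I'. -/

import Mathlib

attribute [local instance] Classical.propDecidable

noncomputable section

namespace KMG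

open Module

/-! ### Generalized Cartan matrices -/

/-- `A` is a generalized Cartan matrix. -/
def IsGCM {I : Type*} (A : Matrix I I ℤ) : Prop :=
  (∀ i, A i i = 2) ∧ (∀ i j, i ≠ j → A i j ≤ 0) ∧ ∀ i j, A i j = 0 → A j i = 0

/-- `A` is indecomposable. -/
def Indecomposable {I : Type*} (A : Matrix I I ℤ) : Prop :=
  ∀ s : Set I, s.Nonempty → sᶜ.Nonempty → ∃ i ∈ s, ∃ j ∈ sᶜ, A i j ≠ 0

/-- `A` is symmetrizable: `D A` is symmetric for an invertible diagonal matrix `D`. -/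
def Symmetrizable {I : Type*} (A : Matrix I I ℤ) : Prop :=
  ∃ d : I → ℚ, (∀ i, d i ≠ 0) ∧ ∀ i j, d i * (A i j : ℚ) = d j * (A j i : ℚ)

/-- The principal submatrix of `A` indexed by a subset `S`. -/
def restrictM {I : Type*} (A : Matrix I I ℤ) (S : Set I) : Matrix S S ℤ :=
  fun i j => A i.1 j.1

/-- `A` is of finite type: `A u > 0` for some `u > 0` (Kac, Thm. 4.3). -/
def IsFiniteType {I : Type*} (A : Matrix I I ℤ) : Prop :=
  ∃ u : I → ℚ, (∀ i, 0 < u i) ∧ ∀ i, 0 < ∑ᶠ j, (A i j : ℚ) * u j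

/-- `A` is of affine type: `A` indecomposable and `A u = 0` for some `u > 0`. -/
def IsAffineType {I : Type*} (A : Matrix I I ℤ) : Prop :=
  Indecomposable A ∧ ∃ u : I → ℚ, (∀ i, 0 < u i) ∧ ∀ i, ∑ᶠ j, (A i j : ℚ) * u j = 0

/-- `A` is of indefinite type: `A u < 0` for some `u > 0`. -/
def IsIndefiniteType {I : Type*} (A : Matrix I I ℤ) : Prop :=
  ∃ u : I → ℚ, (∀ i, 0 < u i) ∧ ∀ i, ∑ᶠ j, (A i j : ℚ) * u j < 0

/-- The corank of a generalized Cartan matrix. -/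
def gcmCorank {I : Type*} [Fintype I] [DecidableEq I] (A : Matrix I I ℤ) : ℕ :=
  Fintype.card I - (A.map ((↑) : ℤ → ℚ)).rank

/-- The connected component of the vertex `k` in the subdiagram of the Dynkin diagram of `A`
with vertex set `S`. -/
def cmpnt {I : Type*} (A : Matrix I I ℤ) (S : Set I) (k : I) : Set I :=
  {i | i ∈ S ∧ Relation.ReflTransGen (fun x y => x ∈ S ∧ y ∈ S ∧ A x y ≠ 0) k i}

/-- `A` is hyperbolic: deleting any one vertex of the Dynkin diagram leaves a disjoint union
of diagrams of finite or affine type. -/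
def IsHyperbolic {I : Type*} (A : Matrix I I ℤ) : Prop :=
  ∀ i₀ k : I, k ≠ i₀ →
    IsFiniteType (restrictM A (cmpnt A {i | i ≠ i₀} k)) ∨
      IsAffineType (restrictM A (cmpnt A {i | i ≠ i₀} k))

/-- `A` is Lorentzian: `A` is nonsingular and its symmetrization has signature `(+,...,+,-)`. -/
def IsLorentzian {I : Type*} [Fintype I] [DecidableEq I] (A : Matrix I I ℤ) : Prop :=
  IsUnit (A.map ((↑) : ℤ → ℚ)).det ∧
    ∃ d : I → ℚ, (∀ i, 0 < d i) ∧ (∀ i j, d i * (A i j : ℚ) = d j * (A j i : ℚ)) ∧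
      ∃ P : Matrix I I ℝ, IsUnit P.det ∧ ∃ i₀ : I,
        P.transpose * (Matrix.of fun i j => ((d i : ℝ) * (A i j : ℝ))) * P =
          Matrix.diagonal fun i => if i = i₀ then (-1 : ℝ) else 1

/-! ### Weight spaces -/

variable {g : Type*} [LieRing g] [LieAlgebra ℂ g]

/-- The weight space of weight `χ` for the adjoint action on `g` of a space `V` mapping to `g`
by `ι`. -/
def wtSpaceι {V : Type*} [AddCommGroup V] [Module ℂ V] (ι : V →ₗ[ℂ] g)
    (χ : Module.Dual ℂ V) : Submodule ℂ g where
  carrier := {x | ∀ v : V, ⁅ι v, x⁆ = χ v • x}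
  add_mem' := fun ha hb v => by rw [lie_add, ha v, hb v, smul_add]
  zero_mem' := fun v => by rw [lie_zero, smul_zero]
  smul_mem' := fun c x hx v => by rw [lie_smul, hx v, smul_comm]

/-! ### Kac-Moody algebras -/

/-- A (symmetrizable) Kac-Moody algebra structure on the Lie algebra `g`, for the generalized
Cartan matrix `A` indexed by `I` : a realization `(H, root, coroot)` of `A` together with
Chevalley generators `e i`, `f i` satisfying the Chevalley-Serre relations, such that `g` is
generated by `H` and the `e i, f i`, is diagonalizable under `H`, with `0`-weight space `H`. -/
structure KacMoodyAlgebra {I : Type*} [Fintype I] [DecidableEq I] (A : Matrix I I ℤ)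
    (g : Type*) [LieRing g] [LieAlgebra ℂ g] : Type _ where
  H : Submodule ℂ g
  root : I → Module.Dual ℂ H
  coroot : I → H
  e : I → g
  f : I → g
  findimH : FiniteDimensional ℂ H
  finrankH : Module.finrank ℂ H = Fintype.card I + gcmCorank A
  indepRoot : LinearIndependent ℂ root
  indepCoroot : LinearIndependent ℂ coroot
  pairing : ∀ i j, root j (coroot i) = (A i j : ℂ)
  abelian : ∀ x y : H, ⁅(x : g), (y : g)⁆ = 0
  lie_e : ∀ (x : H) (i : I), ⁅(x : g), e i⁆ = root i x • e i
  lie_f : ∀ (x : H) (i : I), ⁅(x : g), f i⁆ = -(root i x) • f i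
  e_f : ∀ i j, ⁅e i, f j⁆ = if j = i then ((coroot i : g)) else 0
  serre_e : ∀ i j, i ≠ j →
    ((LieAlgebra.ad ℂ g (e i)) ^ (1 - A i j).toNat) (e j) = 0
  serre_f : ∀ i j, i ≠ j →
    ((LieAlgebra.ad ℂ g (f i)) ^ (1 - A i j).toNat) (f j) = 0
  generates : LieSubalgebra.lieSpan ℂ g ((H : Set g) ∪ Set.range e ∪ Set.range f) = ⊤
  weight_decomp : ⨆ χ : Module.Dual ℂ H, wtSpaceι H.subtype χ = ⊤
  zero_weight : wtSpaceι H.subtype (0 : Module.Dual ℂ H) = H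

variable {I : Type*} [Fintype I] [DecidableEq I] {A : Matrix I I ℤ}

/-- The root system of a Kac-Moody algebra: nonzero weights of the adjoint action of the
Cartan subalgebra. -/
def Delta (G : KacMoodyAlgebra A g) : Set (Module.Dual ℂ G.H) :=
  {χ | χ ≠ 0 ∧ wtSpaceι G.H.subtype χ ≠ ⊥}

/-- The positive roots with respect to the standard root basis. -/
def posRoots (G : KacMoodyAlgebra A g) : Set (Module.Dual ℂ G.H) :=
  {χ ∈ Delta G | ∃ c : I → ℕ, χ = ∑ i, (c i : ℂ) • G.root i}

/-- The real roots : the orbit of the simple roots under the Weyl group. -/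
inductive IsRealRoot (G : KacMoodyAlgebra A g) : Module.Dual ℂ G.H → Prop
  | simple (i : I) : IsRealRoot G (G.root i)
  | reflect (i : I) (χ : Module.Dual ℂ G.H) :
      IsRealRoot G χ → IsRealRoot G (χ - χ (G.coroot i) • G.root i)

/-- The subalgebra `g(S)` generated by the root spaces `g_{± α_i}`, `i ∈ S`. -/
def gS (G : KacMoodyAlgebra A g) (S : Set I) : LieSubalgebra ℂ g :=
  LieSubalgebra.lieSpan ℂ g ({x | ∃ i ∈ S, x = G.e i} ∪ {x | ∃ i ∈ S, x = G.f i})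

/-- The subspace `h^J = {h ∈ h | ⟨α_j, h⟩ = 0 ∀ j ∈ J}`. -/
def hJsub (G : KacMoodyAlgebra A g) (J : Set I) : Submodule ℂ G.H :=
  ⨅ j ∈ J, LinearMap.ker (G.root j)

/-- `Hk` is the canonical semisimple element attached to `k` and the component `S = I_k` :
it lies in the span of the coroots from `S` and satisfies `⟨α_i, H_k⟩ = 2 δ_{i,k}` on `S`. -/
def IsHGen (G : KacMoodyAlgebra A g) (S : Set I) (k : I) (Hk : G.H) : Prop :=
  Hk ∈ Submodule.span ℂ (G.coroot '' S) ∧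
    ∀ i ∈ S, G.root i Hk = if i = k then 2 else 0

/-- `g(S)` is `A₁`-graded by the `sl₂`-triple with semisimple element `Hk` :
`ad Hk` has only eigenvalues `0, 2, -2` on `g(S)`. -/
def A1GradedBy (G : KacMoodyAlgebra A g) (S : Set I) (Hk : g) : Prop :=
  ∀ x ∈ gS G S, x ∈ Module.End.eigenspace (LieAlgebra.ad ℂ g Hk) 0 ⊔
    Module.End.eigenspace (LieAlgebra.ad ℂ g Hk) 2 ⊔
      Module.End.eigenspace (LieAlgebra.ad ℂ g Hk) (-2)

/-- The pair `(I_k, J_k)` (for `I_k` the connected component of `k` in `J ∪ {k}`) is an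
irreducible `C`-admissible pair. -/
def CAdmissibleComponent (G : KacMoodyAlgebra A g) (J : Set I) (k : I) : Prop :=
  IsFiniteType (restrictM A (cmpnt A (J ∪ {k}) k)) ∧
    ∃ Hk : G.H, IsHGen G (cmpnt A (J ∪ {k}) k) k Hk ∧
      ∃ E F : g, E ∈ gS G (cmpnt A (J ∪ {k}) k) ∧ F ∈ gS G (cmpnt A (J ∪ {k}) k) ∧
        IsSl2Triple (Hk : g) E F ∧ A1GradedBy G (cmpnt A (J ∪ {k}) k) (Hk : g)

/-- The data of a `C`-admissible pair `(I, J)` : for each `k ∉ J`, the component `I_k` is of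
finite type and carries an `sl₂`-triple `(E_k, H_k, F_k)` which `A₁`-grades `g(I_k)`. -/
structure CAdmissibleData (G : KacMoodyAlgebra A g) (J : Set I) : Type _ where
  finJ : IsFiniteType (restrictM A J)
  Hc : {k : I // k ∉ J} → G.H
  E : {k : I // k ∉ J} → g
  F : {k : I // k ∉ J} → g
  finIk : ∀ k : {k : I // k ∉ J}, IsFiniteType (restrictM A (cmpnt A (J ∪ {k.1}) k.1))
  isHGen : ∀ k, IsHGen G (cmpnt A (J ∪ {k.1}) k.1) k.1 (Hc k)
  memE : ∀ k, E k ∈ gS G (cmpnt A (J ∪ {k.1}) k.1)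
  memF : ∀ k, F k ∈ gS G (cmpnt A (J ∪ {k.1}) k.1)
  sl2 : ∀ k, IsSl2Triple ((Hc k : g)) (E k) (F k)
  a1 : ∀ k, A1GradedBy G (cmpnt A (J ∪ {k.1}) k.1) ((Hc k : g))

/-- `(I,J)` is a `C`-admissible pair. -/
def CAdmissiblePair (G : KacMoodyAlgebra A g) (J : Set I) : Prop :=
  Nonempty (CAdmissibleData G J)

/-- The data of a `C`-admissible pair `(Itot, J)` for a subdiagram `Itot ⊆ I`. -/
structure CAdmissibleDataIn (G : KacMoodyAlgebra A g) (Itot J : Set I) : Type _ where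
  subJ : J ⊆ Itot
  finJ : IsFiniteType (restrictM A J)
  Hc : {k : I // k ∈ Itot ∧ k ∉ J} → G.H
  E : {k : I // k ∈ Itot ∧ k ∉ J} → g
  F : {k : I // k ∈ Itot ∧ k ∉ J} → g
  finIk : ∀ k : {k : I // k ∈ Itot ∧ k ∉ J},
    IsFiniteType (restrictM A (cmpnt A (J ∪ {k.1}) k.1))
  isHGen : ∀ k, IsHGen G (cmpnt A (J ∪ {k.1}) k.1) k.1 (Hc k)
  memE : ∀ k, E k ∈ gS G (cmpnt A (J ∪ {k.1}) k.1)
  memF : ∀ k, F k ∈ gS G (cmpnt A (J ∪ {k.1}) k.1)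
  sl2 : ∀ k, IsSl2Triple ((Hc k : g)) (E k) (F k)
  a1 : ∀ k, A1GradedBy G (cmpnt A (J ∪ {k.1}) k.1) ((Hc k : g))

/-- The `C`-admissible subalgebra `g^J` : generated by `h^J` and the `E_k, F_k`. -/
def CAdmissibleData.gJ {G : KacMoodyAlgebra A g} {J : Set I} (D : CAdmissibleData G J) :
    LieSubalgebra ℂ g :=
  LieSubalgebra.lieSpan ℂ g
    ((((hJsub G J).map G.H.subtype : Submodule ℂ g) : Set g) ∪ Set.range D.E ∪ Set.range D.F)

/-- `GJ` is "the" Kac-Moody structure on `g^J` associated to a `C`-admissible pair: its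
Cartan subalgebra is `h^J`, its coroots are the `H_k` and its Chevalley generators are the
`E_k, F_k`; the matrix `A'` is `A^J`, i.e. `a'_{k,l} = ⟨α_l, H_k⟩`. -/
def CAdmissibleData.IsAssocKM {G : KacMoodyAlgebra A g} {J : Set I} (D : CAdmissibleData G J)
    {A' : Matrix {k : I // k ∉ J} {k : I // k ∉ J} ℤ}
    (GJ : KacMoodyAlgebra A' ↥D.gJ) : Prop :=
  (∀ k l, (A' k l : ℂ) = G.root l.1 (D.Hc k)) ∧
  GJ.H.map D.gJ.toSubmodule.subtype = (hJsub G J).map G.H.subtype ∧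
  (∀ k, ((GJ.coroot k : ↥D.gJ) : g) = ((D.Hc k : ↥G.H) : g)) ∧
  (∀ k, ((GJ.e k : ↥D.gJ) : g) = D.E k) ∧ (∀ k, ((GJ.f k : ↥D.gJ) : g) = D.F k)

/-! ### Finite gradations -/

/-- `g` is finitely `Σ`-graded, where `Σ` is the root system of the Kac-Moody algebra `m`
(with Kac-Moody structure `M`) and `m` is embedded in `g` by `φ` (the grading subalgebra is
the image of `φ`): `g` is the sum of the weight spaces `V_γ`, `γ ∈ Σ ∪ {0}`, of the adjoint
action of the Cartan subalgebra of `m`, and each `V_γ` is finite dimensional. -/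
def IsFinGrading {S : Type*} [Fintype S] [DecidableEq S] {B : Matrix S S ℤ}
    {m : Type*} [LieRing m] [LieAlgebra ℂ m] (M : KacMoodyAlgebra B m)
    (φ : m →ₗ⁅ℂ⁆ g) : Prop :=
  Function.Injective φ ∧
  (⨆ χ ∈ insert (0 : Module.Dual ℂ M.H) (Delta M),
      wtSpaceι (φ.toLinearMap ∘ₗ M.H.subtype) χ) = ⊤ ∧
  ∀ χ ∈ insert (0 : Module.Dual ℂ M.H) (Delta M),
      FiniteDimensional ℂ (wtSpaceι (φ.toLinearMap ∘ₗ M.H.subtype) χ)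

section Grading

variable {S : Type*} [Fintype S] [DecidableEq S] {B : Matrix S S ℤ}
variable {m : Type*} [LieRing m] [LieAlgebra ℂ m]

/-- The inclusion of the Cartan subalgebra of the grading subalgebra into the Cartan
subalgebra of `g` (given `a ⊆ h`). -/
def cartanIncl (G : KacMoodyAlgebra A g) (M : KacMoodyAlgebra B m) (φ : m →ₗ⁅ℂ⁆ g)
    (hle : M.H.map φ.toLinearMap ≤ G.H) : M.H →ₗ[ℂ] G.H :=
  LinearMap.codRestrict G.H (φ.toLinearMap ∘ₗ M.H.subtype)
    (fun x => hle (Submodule.mem_map_of_mem x.2))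

/-- The restriction `ρ_a(χ)` to the Cartan subalgebra `a` of `m` of a linear form `χ` on `h`. -/
def resD (G : KacMoodyAlgebra A g) (M : KacMoodyAlgebra B m) (φ : m →ₗ⁅ℂ⁆ g)
    (hle : M.H.map φ.toLinearMap ≤ G.H) (χ : Module.Dual ℂ G.H) : Module.Dual ℂ M.H :=
  χ.comp (cartanIncl G M φ hle)

/-- The restriction `ρ_a(α_i)` of the simple root `α_i` to `a`. -/
def resRoot (G : KacMoodyAlgebra A g) (M : KacMoodyAlgebra B m) (φ : m →ₗ⁅ℂ⁆ g)
    (hle : M.H.map φ.toLinearMap ≤ G.H) (i : I) : Module.Dual ℂ M.H :=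
  resD G M φ hle (G.root i)

/-- The root basis of `M` is adapted to the root basis of `G` :
`ρ_a(Δ⁺) ⊆ Σ⁺ ∪ {0}`. -/
def Adapted (G : KacMoodyAlgebra A g) (M : KacMoodyAlgebra B m) (φ : m →ₗ⁅ℂ⁆ g)
    (hle : M.H.map φ.toLinearMap ≤ G.H) : Prop :=
  ∀ χ ∈ posRoots G, resD G M φ hle χ = 0 ∨ resD G M φ hle χ ∈ posRoots M

/-- The set `J = {i ∈ I | ρ_a(α_i) = 0}`. -/
def Jof (G : KacMoodyAlgebra A g) (M : KacMoodyAlgebra B m) (φ : m →ₗ⁅ℂ⁆ g)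
    (hle : M.H.map φ.toLinearMap ≤ G.H) : Set I :=
  {i | resRoot G M φ hle i = 0}

/-- The set `Γ_s = {i ∈ I' | ρ_a(α_i) = γ_s}`. -/
def GammaOf (G : KacMoodyAlgebra A g) (M : KacMoodyAlgebra B m) (φ : m →ₗ⁅ℂ⁆ g)
    (hle : M.H.map φ.toLinearMap ≤ G.H) (s : S) : Set I :=
  {i | resRoot G M φ hle i = M.root s}

/-- The set `I'_re = {i ∈ I' | ρ_a(α_i) ∈ Π_a}`. -/
def IpRe (G : KacMoodyAlgebra A g) (M : KacMoodyAlgebra B m) (φ : m →ₗ⁅ℂ⁆ g)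
    (hle : M.H.map φ.toLinearMap ≤ G.H) : Set I :=
  {i | ∃ s : S, resRoot G M φ hle i = M.root s}

/-- The set `I'_im = {i ∈ I | ρ_a(α_i) ∉ Π_a ∪ {0}}`. -/
def IpIm (G : KacMoodyAlgebra A g) (M : KacMoodyAlgebra B m) (φ : m →ₗ⁅ℂ⁆ g)
    (hle : M.H.map φ.toLinearMap ≤ G.H) : Set I :=
  {i | resRoot G M φ hle i ≠ 0 ∧ ∀ s : S, resRoot G M φ hle i ≠ M.root s}

/-- The set `I_re` : union of the components `I_k`, `k ∈ I'_re`. -/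
def IreOf (G : KacMoodyAlgebra A g) (M : KacMoodyAlgebra B m) (φ : m →ₗ⁅ℂ⁆ g)
    (hle : M.H.map φ.toLinearMap ≤ G.H) : Set I :=
  {i | ∃ k ∈ IpRe G M φ hle, i ∈ cmpnt A (Jof G M φ hle ∪ {k}) k}

/-- `g` is maximally finitely graded: finitely graded, with `a ⊆ h`, the root basis of the
grading subalgebra adapted, and the corresponding sets `J` and `I'_im` empty. -/
def MaxFinGrading (G : KacMoodyAlgebra A g) (M : KacMoodyAlgebra B m) (φ : m →ₗ⁅ℂ⁆ g) : Prop :=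
  IsFinGrading M φ ∧ ∃ hle : M.H.map φ.toLinearMap ≤ G.H,
    Adapted G M φ hle ∧ Jof G M φ hle = ∅ ∧ IpIm G M φ hle = ∅

end Grading

/-- `(π, πv)` is a root basis (with generalized Cartan matrix `B`) of the root system `Rts`. -/
def IsRootBasis {V : Type*} [AddCommGroup V] [Module ℂ V] {S : Type*} [Fintype S]
    (B : Matrix S S ℤ) (Rts : Set (Module.Dual ℂ V)) (π : S → Module.Dual ℂ V)
    (πv : S → V) : Prop :=
  LinearIndependent ℂ π ∧ LinearIndependent ℂ πv ∧
  (∀ s t, π t (πv s) = (B s t : ℂ)) ∧ (∀ s, π s ∈ Rts) ∧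
  ∀ χ ∈ Rts, (∃ c : S → ℕ, χ = ∑ s, (c s : ℂ) • π s) ∨
    (∃ c : S → ℕ, χ = -∑ s, (c s : ℂ) • π s)

/-- `Bf` is a nondegenerate invariant symmetric bilinear form on `g`. -/
def InvariantForm (Bf : g →ₗ[ℂ] g →ₗ[ℂ] ℂ) : Prop :=
  (∀ x y, Bf x y = Bf y x) ∧ (∀ x y z, Bf ⁅x, y⁆ z = Bf x ⁅y, z⁆) ∧
  ∀ x, (∀ y, Bf x y = 0) → x = 0

/-- `Bf` is "the" invariant bilinear form of the Kac-Moody algebra `G` : nondegenerate,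
invariant, symmetric, with `(α_i∨, α_i∨)` a positive rational for all `i`. -/
def NormalizedInvForm (G : KacMoodyAlgebra A g) (Bf : g →ₗ[ℂ] g →ₗ[ℂ] ℂ) : Prop :=
  InvariantForm Bf ∧ ∀ i : I, ∃ q : ℚ, 0 < q ∧ Bf ((G.coroot i : g)) ((G.coroot i : g)) = (q : ℂ)

/-- `(e', f')` is a system of Chevalley generators for `G` (with the given Cartan subalgebra,
simple roots and coroots). -/
def IsChevalleyGens (G : KacMoodyAlgebra A g) (e' f' : I → g) : Prop :=
  (∀ (x : G.H) (i : I), ⁅(x : g), e' i⁆ = G.root i x • e' i) ∧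
  (∀ (x : G.H) (i : I), ⁅(x : g), f' i⁆ = -(G.root i x) • f' i) ∧
  (∀ i j, ⁅e' i, f' j⁆ = if j = i then ((G.coroot i : g)) else 0) ∧
  (∀ i j, i ≠ j → ((LieAlgebra.ad ℂ g (e' i)) ^ (1 - A i j).toNat) (e' j) = 0) ∧
  (∀ i j, i ≠ j → ((LieAlgebra.ad ℂ g (f' i)) ^ (1 - A i j).toNat) (f' j) = 0) ∧
  LieSubalgebra.lieSpan ℂ g ((G.H : Set g) ∪ Set.range e' ∪ Set.range f') = ⊤


/-- The subalgebra `g(I_re)` of `g` generated by `h_{I_re}` and the `e_i, f_i`, `i ∈ I_re`. -/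
def gIre (G : KacMoodyAlgebra A g) (Ire : Set I) (hIre : Submodule ℂ g) : LieSubalgebra ℂ g :=
  LieSubalgebra.lieSpan ℂ g
    ((hIre : Set g) ∪ {x | ∃ i ∈ Ire, x = G.e i} ∪ {x | ∃ i ∈ Ire, x = G.f i})

/-- `GI` is "the" Kac-Moody structure on `g(I_re)` : its Cartan subalgebra is `h_{I_re}`,
its coroots and Chevalley generators are the `α_i∨, e_i, f_i` of `g`, for `i ∈ I_re`. -/
def IsAssocKMIre (G : KacMoodyAlgebra A g) (Ire : Set I) (hIre : Submodule ℂ g)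
    {A'' : Matrix ↥Ire ↥Ire ℤ} (GI : KacMoodyAlgebra A'' ↥(gIre G Ire hIre)) : Prop :=
  GI.H.map (gIre G Ire hIre).toSubmodule.subtype = hIre ∧
  (∀ i, ((GI.coroot i : ↥(gIre G Ire hIre)) : g) = ((G.coroot i.1 : ↥G.H) : g)) ∧
  (∀ i, ((GI.e i : ↥(gIre G Ire hIre)) : g) = G.e i.1) ∧
  (∀ i, ((GI.f i : ↥(gIre G Ire hIre)) : g) = G.f i.1)

/-! ### Admissible quotients and maximal gradations -/

/-- `ρ : I → S` is an admissible quotient map for `A` : fibers are totally disconnected (MG1)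
and the column sums over a fiber are constant along fibers (MG2). -/
def AdmissibleQuotient {I S : Type*} (A : Matrix I I ℤ) (ρ : I → S) : Prop :=
  Function.Surjective ρ ∧
  (∀ k l, k ≠ l → ρ k = ρ l → A k l = 0) ∧
  ∀ s t : S, s ≠ t → ∀ j j', ρ j = t → ρ j' = t →
    ∑ᶠ i ∈ {i | ρ i = s}, A i j = ∑ᶠ i ∈ {i | ρ i = s}, A i j'

section Quotient

variable {S : Type*} [Fintype S] [DecidableEq S]

/-- `γ_s∨ = ∑_{k ∈ Γ_s} α_k∨`. -/
def gammaV (G : KacMoodyAlgebra A g) (ρ : I → S) (s : S) : G.H :=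
  ∑ᶠ k ∈ {k | ρ k = s}, G.coroot k

/-- `X̄_s = ∑_{k ∈ Γ_s} e_k`. -/
def Xbar (G : KacMoodyAlgebra A g) (ρ : I → S) (s : S) : g :=
  ∑ᶠ k ∈ {k | ρ k = s}, G.e k

/-- `Ȳ_s = ∑_{k ∈ Γ_s} f_k`. -/
def Ybar (G : KacMoodyAlgebra A g) (ρ : I → S) (s : S) : g :=
  ∑ᶠ k ∈ {k | ρ k = s}, G.f k

/-- The subalgebra `g^ρ` generated by `a` and the `X̄_s, Ȳ_s`. -/
def gRho (G : KacMoodyAlgebra A g) (ρ : I → S) (a : Submodule ℂ G.H) : LieSubalgebra ℂ g :=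
  LieSubalgebra.lieSpan ℂ g
    (((a.map G.H.subtype : Submodule ℂ g) : Set g) ∪ Set.range (Xbar G ρ) ∪
      Set.range (Ybar G ρ))

/-- `Gρ` is "the" Kac-Moody structure on `g^ρ` : its Cartan subalgebra is `a`, its coroots
are the `γ_s∨` and its Chevalley generators are the `X̄_s, Ȳ_s`. -/
def IsAssocKMrho (G : KacMoodyAlgebra A g) (ρ : I → S) (a : Submodule ℂ G.H)
    {Abar : Matrix S S ℤ} (Gρ : KacMoodyAlgebra Abar ↥(gRho G ρ a)) : Prop :=
  Gρ.H.map (gRho G ρ a).toSubmodule.subtype = a.map G.H.subtype ∧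
  (∀ s, ((Gρ.coroot s : ↥(gRho G ρ a)) : g) = ((gammaV G ρ s : ↥G.H) : g)) ∧
  (∀ s, ((Gρ.e s : ↥(gRho G ρ a)) : g) = Xbar G ρ s) ∧
  (∀ s, ((Gρ.f s : ↥(gRho G ρ a)) : g) = Ybar G ρ s)

end Quotient

end KMG

namespace KMG

/-! ### Locally nilpotent elements -/

section LocallyNilpotent

open LieAlgebra

variable {L : Type*} [LieRing L] [LieAlgebra ℂ L]

/-- The adjoint action of `x` is locally nilpotent. -/
def LocNil (x : L) : Prop := ∀ y, ∃ n : ℕ, ((ad ℂ L x) ^ n) y = 0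

theorem pow_apply_eq_zero_of_le {M : Type*} [AddCommGroup M] [Module ℂ M] (T : Module.End ℂ M)
    {m n : ℕ} {y : M} (h : (T ^ m) y = 0) (hmn : m ≤ n) : (T ^ n) y = 0 := by
  obtain ⟨k, rfl⟩ := Nat.exists_eq_add_of_le' hmn
  rw [pow_add, Module.End.mul_apply, h, map_zero]

theorem locNil_of_lieSpan {x : L} {s : Set L} (hs : LieSubalgebra.lieSpan ℂ L s = ⊤)
    (h : ∀ y ∈ s, ∃ n : ℕ, ((ad ℂ L x) ^ n) y = 0) : LocNil x := by
  intro y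
  rw [← LieSubalgebra.mem_engel_iff]
  have : LieSubalgebra.lieSpan ℂ L s ≤ LieSubalgebra.engel ℂ x :=
    LieSubalgebra.lieSpan_le.2 fun z hz => (LieSubalgebra.mem_engel_iff ℂ x z).2 (h z hz)
  exact this (hs ▸ LieSubalgebra.mem_top y)

theorem LocNil.zero : LocNil (0 : L) := fun y => ⟨1, by simp⟩

theorem LocNil.smul {x : L} (hx : LocNil x) (c : ℂ) : LocNil (c • x) := fun y => by
  obtain ⟨n, hn⟩ := hx y
  exact ⟨n, by rw [map_smul, smul_pow, LinearMap.smul_apply, hn, smul_zero]⟩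

theorem LocNil.add {x y : L} (hx : LocNil x) (hy : LocNil y) (hxy : ⁅x, y⁆ = 0) :
    LocNil (x + y) := fun z => by
  have hc : Commute (ad ℂ L x) (ad ℂ L y) := by
    refine LinearMap.ext fun w => ?_
    simp only [Module.End.mul_apply, ad_apply]
    rw [leibniz_lie, hxy, zero_lie, zero_add]
  obtain ⟨a, ha⟩ := hx z
  choose b hb using fun i => hy (((ad ℂ L x) ^ i) z)
  refine ⟨a + (Finset.range a).sup b, ?_⟩
  rw [map_add, hc.add_pow, LinearMap.sum_apply]
  refine Finset.sum_eq_zero fun m _ => ?_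
  rw [(hc.pow_pow _ _).eq, ← nsmul_eq_mul', LinearMap.smul_apply, Module.End.mul_apply]
  rcases lt_or_ge m a with hm | hm
  · rw [pow_apply_eq_zero_of_le _ (hb m), smul_zero]
    have := Finset.le_sup (f := b) (Finset.mem_range.2 hm)
    omega
  · rw [pow_apply_eq_zero_of_le _ ha hm, map_zero, smul_zero]

/-- The truncated exponential series of `t • ad d`, applied to `y`. -/
def expSum (d : L) (t : ℂ) (n : ℕ) (y : L) : L :=
  ∑ i ∈ Finset.range n, (t ^ i * (i.factorial : ℂ)⁻¹) • ((ad ℂ L d) ^ i) y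

theorem expSum_eq_of_le {d : L} {t : ℂ} {m n : ℕ} {y : L} (h : ((ad ℂ L d) ^ m) y = 0)
    (hmn : m ≤ n) : expSum d t n y = expSum d t m y := by
  refine (Finset.sum_subset (Finset.range_mono hmn) fun i _ hi => ?_).symm
  rw [pow_apply_eq_zero_of_le _ h (by simpa using hi), smul_zero]

/-- The exponential of `t • ad d` for a locally nilpotent element `d`. -/
def expAd (d : L) (hd : LocNil d) (t : ℂ) : L →ₗ[ℂ] L where
  toFun y := expSum d t (Nat.find (hd y)) y
  map_add' x y := by
    set N := max (max (Nat.find (hd x)) (Nat.find (hd y))) (Nat.find (hd (x + y)))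
    rw [← expSum_eq_of_le (n := N) (Nat.find_spec (hd x)) (by omega),
      ← expSum_eq_of_le (n := N) (Nat.find_spec (hd y)) (by omega),
      ← expSum_eq_of_le (n := N) (Nat.find_spec (hd (x + y))) (by omega)]
    simp [expSum, smul_add, Finset.sum_add_distrib]
  map_smul' c x := by
    set N := max (Nat.find (hd x)) (Nat.find (hd (c • x)))
    rw [← expSum_eq_of_le (n := N) (Nat.find_spec (hd x)) (by omega),
      ← expSum_eq_of_le (n := N) (Nat.find_spec (hd (c • x))) (by omega)]
    simp only [expSum, map_smul, RingHom.id_apply, Finset.smul_sum]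
    exact Finset.sum_congr rfl fun i _ => smul_comm _ _ _

theorem expAd_eq {d : L} (hd : LocNil d) (t : ℂ) {n : ℕ} {y : L} (h : ((ad ℂ L d) ^ n) y = 0) :
    expAd d hd t y = expSum d t n y :=
  (expSum_eq_of_le (Nat.find_spec (hd y)) (Nat.find_min' (hd y) h)).symm

theorem ad_pow_lie (d x y : L) (n : ℕ) : ((ad ℂ L d) ^ n) ⁅x, y⁆ =
    ∑ ij ∈ Finset.HasAntidiagonal.antidiagonal n,
      n.choose ij.1 • ⁅((ad ℂ L d) ^ ij.1) x, ((ad ℂ L d) ^ ij.2) y⁆ := by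
  have := LieDerivation.iterate_apply_lie (LieDerivation.ad ℂ L d) n x y
  have hc : (⇑(LieDerivation.ad ℂ L d) : L → L) = ⇑(ad ℂ L d) :=
    funext fun _ => by simp
  simpa only [Module.End.pow_apply, hc] using this

theorem expAd_lie {d : L} (hd : LocNil d) (t : ℂ) (x y : L) :
    expAd d hd t ⁅x, y⁆ = ⁅expAd d hd t x, expAd d hd t y⁆ := by
  obtain ⟨a, ha⟩ := hd x
  obtain ⟨b, hb⟩ := hd y
  have hterm : ∀ n, ∀ ij ∈ Finset.HasAntidiagonal.antidiagonal n,
      (t ^ n * (n.factorial : ℂ)⁻¹) •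
        (n.choose ij.1 • ⁅((ad ℂ L d) ^ ij.1) x, ((ad ℂ L d) ^ ij.2) y⁆) =
      ⁅(t ^ ij.1 * (ij.1.factorial : ℂ)⁻¹) • ((ad ℂ L d) ^ ij.1) x,
        (t ^ ij.2 * (ij.2.factorial : ℂ)⁻¹) • ((ad ℂ L d) ^ ij.2) y⁆ := by
    rintro n ⟨i, j⟩ hij
    obtain rfl : i + j = n := by simpa using hij
    rw [smul_lie, lie_smul, smul_smul, ← Nat.cast_smul_eq_nsmul ℂ, smul_smul]
    congr 1
    have h1 := (Nat.factorial_ne_zero (i + j))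
    have h2 := (Nat.factorial_ne_zero i)
    have h3 := (Nat.factorial_ne_zero j)
    have h4 : ((i + j).choose i : ℂ) * i.factorial * j.factorial = (i + j).factorial := by
      rw [Nat.choose_symm_add]
      exact_mod_cast Nat.add_choose_mul_factorial_mul_factorial i j
    rw [← h4, pow_add]
    have h5 : ((i + j).choose i : ℂ) ≠ 0 := by
      exact_mod_cast (Nat.choose_pos (Nat.le_add_right i j)).ne'
    field_simp
  have hz : ∀ i j : ℕ, a ≤ i ∨ b ≤ j →
      ⁅(t ^ i * (i.factorial : ℂ)⁻¹) • ((ad ℂ L d) ^ i) x,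
        (t ^ j * (j.factorial : ℂ)⁻¹) • ((ad ℂ L d) ^ j) y⁆ = 0 := by
    rintro i j (h | h)
    · rw [pow_apply_eq_zero_of_le _ ha h, smul_zero, zero_lie]
    · rw [pow_apply_eq_zero_of_le _ hb h, smul_zero, lie_zero]
  have hab : ((ad ℂ L d) ^ (a + b)) ⁅x, y⁆ = 0 := by
    rw [ad_pow_lie]
    refine Finset.sum_eq_zero fun ij hij => ?_
    rw [Finset.HasAntidiagonal.mem_antidiagonal] at hij
    rcases le_or_gt a ij.1 with h | h
    · rw [pow_apply_eq_zero_of_le _ ha h, zero_lie, smul_zero]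
    · rw [pow_apply_eq_zero_of_le _ hb (by omega), lie_zero, smul_zero]
  rw [expAd_eq hd t hab, expAd_eq hd t ha, expAd_eq hd t hb]
  simp only [expSum, sum_lie_sum]
  rw [← Finset.sum_product', Finset.sum_congr rfl fun n _ => by
    rw [ad_pow_lie, Finset.smul_sum, Finset.sum_congr rfl (hterm n)], Finset.sum_sigma']
  symm
  refine Finset.sum_bij_ne_zero (fun p _ _ => ⟨p.1 + p.2, p⟩) ?_ ?_ ?_ ?_
  · rintro ⟨i, j⟩ h _
    simp only [Finset.mem_product, Finset.mem_range] at h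
    simp only [Finset.mem_sigma, Finset.mem_range, Finset.HasAntidiagonal.mem_antidiagonal,
      and_true]
    omega
  · rintro p _ _ q _ _ h
    simpa using (Sigma.mk.inj_iff.1 h).2
  · rintro ⟨n, i, j⟩ h hne
    simp only [Finset.mem_sigma, Finset.mem_range, Finset.HasAntidiagonal.mem_antidiagonal] at h
    obtain ⟨_, rfl⟩ := h
    refine ⟨(i, j), ?_, hne, rfl⟩
    by_contra hc
    refine hne (hz i j ?_)
    simp only [Finset.mem_product, Finset.mem_range] at hc
    omega
  · intros; rfl

theorem expAd_surjective {d : L} (hd : LocNil d) (t : ℂ) : Function.Surjective (expAd d hd t) := by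
  have key : ∀ n : ℕ, ∀ y : L, ((ad ℂ L d) ^ n) y = 0 → y ∈ LinearMap.range (expAd d hd t) := by
    intro n
    induction n with
    | zero => intro y hy; rw [show y = 0 by simpa using hy]; exact zero_mem _
    | succ n ih =>
      intro y hy
      have h : y - expAd d hd t y ∈ LinearMap.range (expAd d hd t) := by
        refine ih _ ?_
        rw [expAd_eq hd t hy, expSum, Finset.sum_range_succ', map_sub, map_add, map_sum,
          Finset.sum_eq_zero]
        · simp
        · intro i _
          rw [map_smul, ← Module.End.mul_apply, ← pow_add, pow_apply_eq_zero_of_le _ hy (by omega),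
            smul_zero]
      simpa using add_mem h (LinearMap.mem_range_self (expAd d hd t) y)
  intro y
  obtain ⟨n, hn⟩ := hd y
  exact key n y hn

theorem LocNil.expAd {d : L} (hd : LocNil d) (t : ℂ) {x : L} (hx : LocNil x) :
    LocNil (expAd d hd t x) := by
  intro y
  obtain ⟨z, rfl⟩ := expAd_surjective hd t y
  obtain ⟨n, hn⟩ := hx z
  refine ⟨n, ?_⟩
  have : ∀ m : ℕ, ((ad ℂ L (KMG.expAd d hd t x)) ^ m) (KMG.expAd d hd t z) =
      KMG.expAd d hd t (((ad ℂ L x) ^ m) z) := by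
    intro m
    induction m with
    | zero => simp
    | succ m ih => rw [pow_succ', pow_succ', Module.End.mul_apply, Module.End.mul_apply, ih,
        ad_apply, ad_apply, expAd_lie]
  rw [this, hn, map_zero]

theorem coeff_mem_of_forall_sum_mem {M : Type*} [AddCommGroup M] [Module ℂ M]
    (W : Submodule ℂ M) (n : ℕ) (a : ℕ → M)
    (h : ∀ t : ℂ, ∑ i ∈ Finset.range n, t ^ i • a i ∈ W) {i : ℕ} (hi : i < n) : a i ∈ W := by
  rw [← Submodule.Quotient.mk_eq_zero, ← Module.forall_dual_apply_eq_zero_iff ℂ]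
  intro φ
  let p : Polynomial ℂ :=
    ∑ j ∈ Finset.range n, Polynomial.monomial j (φ (Submodule.Quotient.mk (a j)))
  have hp : p = 0 := by
    refine Polynomial.funext fun t => ?_
    have := (Submodule.Quotient.mk_eq_zero W).2 (h t)
    have h2 := congrArg φ this
    simp only [← Submodule.mkQ_apply, map_sum, map_smul, map_zero, smul_eq_mul] at h2
    simp only [p, Polynomial.eval_finsetSum, Polynomial.eval_monomial, Polynomial.eval_zero,
      ← Submodule.mkQ_apply, ← h2]
    exact Finset.sum_congr rfl fun _ _ => mul_comm _ _
  have := congrArg (Polynomial.coeff · i) hp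
  simpa [p, Polynomial.finsetSum_coeff, Polynomial.coeff_monomial, hi] using this

/-- In a space of pairwise commuting elements which is stable under a locally nilpotent element
`d`, the locally nilpotent elements are stable under `d`. -/
theorem LocNil.lie {V : Submodule ℂ L} (hV : ∀ x ∈ V, ∀ y ∈ V, ⁅x, y⁆ = 0) {d : L}
    (hd : LocNil d) (hdV : ∀ x ∈ V, ⁅d, x⁆ ∈ V) {x : L} (hxV : x ∈ V) (hx : LocNil x) :
    LocNil ⁅d, x⁆ := by
  let W : Submodule ℂ L :=
    { carrier := {x | x ∈ V ∧ LocNil x}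
      add_mem' := fun ha hb => ⟨add_mem ha.1 hb.1, ha.2.add hb.2 (hV _ ha.1 _ hb.1)⟩
      zero_mem' := ⟨zero_mem _, LocNil.zero⟩
      smul_mem' := fun c _ ha => ⟨V.smul_mem c ha.1, ha.2.smul c⟩ }
  have hpow : ∀ i : ℕ, ((ad ℂ L d) ^ i) x ∈ V := by
    intro i
    induction i with
    | zero => simpa
    | succ i ih => rw [pow_succ', Module.End.mul_apply]; exact hdV _ ih
  obtain ⟨n, hn⟩ := hd x
  have hn2 := pow_apply_eq_zero_of_le _ hn (Nat.le_add_right n 2)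
  have : (Nat.factorial 1 : ℂ)⁻¹ • ((ad ℂ L d) ^ 1) x ∈ W := by
    refine coeff_mem_of_forall_sum_mem W (n + 2)
      (fun i => (i.factorial : ℂ)⁻¹ • ((ad ℂ L d) ^ i) x) (fun t => ?_) (by omega)
    have h : ∑ i ∈ Finset.range (n + 2), t ^ i • ((i.factorial : ℂ)⁻¹ • ((ad ℂ L d) ^ i) x) =
        KMG.expAd d hd t x := by
      rw [expAd_eq hd t hn2, expSum]
      exact Finset.sum_congr rfl fun i _ => smul_smul _ _ _
    refine ⟨?_, h ▸ LocNil.expAd hd t hx⟩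
    exact sum_mem fun i _ => V.smul_mem _ (V.smul_mem _ (hpow i))
  simpa using this.2

end LocallyNilpotent

/-! ### The Chevalley involution on the data -/

section Swap

variable {I : Type*} [Fintype I] [DecidableEq I] {A : Matrix I I ℤ}
variable {g : Type*} [LieRing g] [LieAlgebra ℂ g]

/-- The Kac-Moody structure obtained by exchanging the generators `e i` and `f i`. -/
abbrev KacMoodyAlgebra.swap (G : KacMoodyAlgebra A g) : KacMoodyAlgebra A g where
  H := G.H
  root i := -G.root i
  coroot i := -G.coroot i
  e := G.f
  f := G.e
  findimH := G.findimH
  finrankH := G.finrankH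
  indepRoot := by
    have := G.indepRoot.units_smul fun _ => (-1 : ℂˣ)
    convert this using 2
    ext; simp
  indepCoroot := by
    have := G.indepCoroot.units_smul fun _ => (-1 : ℂˣ)
    convert this using 2
    ext; simp
  pairing i j := by simp [G.pairing]
  abelian := G.abelian
  lie_e x i := by rw [G.lie_f]; simp
  lie_f x i := by rw [G.lie_e]; simp
  e_f i j := by
    rw [← lie_skew, G.e_f]
    by_cases h : i = j
    · subst h; simp
    · simp [h, Ne.symm h]
  serre_e := G.serre_f
  serre_f := G.serre_e
  generates := by
    rw [Set.union_assoc, Set.union_comm (Set.range G.f), ← Set.union_assoc, G.generates]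
  weight_decomp := G.weight_decomp
  zero_weight := G.zero_weight

theorem gS_swap (G : KacMoodyAlgebra A g) (S : Set I) : gS G.swap S = gS G S := by
  rw [gS, gS, Set.union_comm]

theorem hJsub_swap (G : KacMoodyAlgebra A g) (J : Set I) : hJsub G.swap J = hJsub G J := by
  ext x
  simp [hJsub]

theorem IsHGen.swap {G : KacMoodyAlgebra A g} {S : Set I} {k : I} {Hk : G.H}
    (h : IsHGen G S k Hk) : IsHGen G.swap S k (-Hk : G.H) := by
  refine ⟨?_, fun i hi => by simpa using h.2 i hi⟩
  have : (G.swap.coroot '' S : Set G.H) = -(G.coroot '' S) := by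
    ext x
    simp [neg_eq_iff_eq_neg]
  rw [this, Submodule.span_neg]
  exact neg_mem h.1

theorem A1GradedBy.swap {G : KacMoodyAlgebra A g} {S : Set I} {x : g}
    (h : A1GradedBy G S x) : A1GradedBy G.swap S (-x) := by
  have key : ∀ c : ℂ, Module.End.eigenspace (LieAlgebra.ad ℂ g (-x)) c =
      Module.End.eigenspace (LieAlgebra.ad ℂ g x) (-c) := by
    intro c
    ext y
    simp only [Module.End.mem_eigenspace_iff, map_neg, LinearMap.neg_apply, neg_smul,
      neg_eq_iff_eq_neg]
  intro y hy
  rw [gS_swap] at hy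
  have := h y hy
  rw [key, key, key, neg_zero, neg_neg, sup_right_comm]
  exact this

/-- The `C`-admissible data obtained by exchanging the `E k` and `F k`. -/
abbrev CAdmissibleData.swap {G : KacMoodyAlgebra A g} {J : Set I} (D : CAdmissibleData G J) :
    CAdmissibleData G.swap J where
  finJ := D.finJ
  Hc k := -D.Hc k
  E := D.F
  F := D.E
  finIk := D.finIk
  isHGen k := (D.isHGen k).swap
  memE k := by rw [gS_swap]; exact D.memF k
  memF k := by rw [gS_swap]; exact D.memE k
  sl2 k := by
    have := (D.sl2 k).symm
    simpa using this
  a1 k := by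
    have := (D.a1 k).swap
    simpa using this

end Swap

/-! ### Positive parts of graded Levi-type subalgebras -/

section PositivePart

open LieAlgebra

variable {I : Type*} [Fintype I] [DecidableEq I] {A : Matrix I I ℤ}
variable {g : Type*} [LieRing g] [LieAlgebra ℂ g]

/-- The subalgebra of elements whose adjoint action preserves a subspace. -/
def stabilizer (W : Submodule ℂ g) : LieSubalgebra ℂ g where
  carrier := {x | ∀ w ∈ W, ⁅x, w⁆ ∈ W}
  add_mem' ha hb w hw := by rw [add_lie]; exact add_mem (ha w hw) (hb w hw)
  zero_mem' w _ := by rw [zero_lie]; exact zero_mem _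
  smul_mem' c x hx w hw := by rw [smul_lie]; exact W.smul_mem c (hx w hw)
  lie_mem' {x y} hx hy w hw := by
    rw [lie_lie]
    exact sub_mem (hx _ (hy _ hw)) (hy _ (hx _ hw))

theorem lieSpan_le_of_stabilizer {s : Set g} {W : Submodule ℂ g} (h₁ : s ⊆ W)
    (h₂ : ∀ x ∈ s, x ∈ stabilizer W) : (LieSubalgebra.lieSpan ℂ g s).toSubmodule ≤ W := by
  have h : LieSubalgebra.lieSpan ℂ g s ≤ stabilizer W := LieSubalgebra.lieSpan_le.2 h₂
  intro x hx
  induction hx using LieSubalgebra.lieSpan_induction with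
  | mem x hx => exact h₁ hx
  | zero => exact zero_mem _
  | add x y _ _ hx hy => exact add_mem hx hy
  | smul c x _ hx => exact W.smul_mem c hx
  | lie x y hx _ _ hy => exact h hx _ hy

/-- The smallest subspace containing `e k` and stable under the `e j`, `j ∈ S`. -/
def upU (G : KacMoodyAlgebra A g) (S : Set I) (k : I) : Submodule ℂ g :=
  sInf {W | G.e k ∈ W ∧ ∀ j ∈ S, ∀ x ∈ W, ⁅G.e j, x⁆ ∈ W}

variable (G : KacMoodyAlgebra A g) (S : Set I) (k : I)

theorem e_mem_upU : G.e k ∈ upU G S k := by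
  simp only [upU, Submodule.mem_sInf]
  exact fun W hW => hW.1

variable {G S k}

theorem lie_e_mem_upU {j : I} (hj : j ∈ S) {x : g} (hx : x ∈ upU G S k) :
    ⁅G.e j, x⁆ ∈ upU G S k := by
  simp only [upU, Submodule.mem_sInf] at hx ⊢
  exact fun W hW => hW.2 j hj x (hx W hW)

theorem upU_le {W : Submodule ℂ g} (h₁ : G.e k ∈ W)
    (h₂ : ∀ j ∈ S, ∀ x ∈ W, ⁅G.e j, x⁆ ∈ W) : upU G S k ≤ W := sInf_le ⟨h₁, h₂⟩

theorem upU_induction {p : g → Prop} (W : Submodule ℂ g) (hW : ∀ x, x ∈ W ↔ p x)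
    (h₁ : p (G.e k)) (h₂ : ∀ j ∈ S, ∀ x ∈ upU G S k, p x → p ⁅G.e j, x⁆)
    {x : g} (hx : x ∈ upU G S k) : p x := by
  have : upU G S k ≤ W ⊓ upU G S k := upU_le ⟨(hW _).2 h₁, e_mem_upU G S k⟩ fun j hj x hx =>
    ⟨(hW _).2 (h₂ j hj x hx.2 ((hW _).1 hx.1)), lie_e_mem_upU hj hx.2⟩
  exact (hW _).1 (this hx).1

theorem upU_le_gS {T : Set I} (hk : k ∈ T) (hS : S ⊆ T) :
    upU G S k ≤ (gS G T).toSubmodule :=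
  upU_le (LieSubalgebra.subset_lieSpan (Or.inl ⟨k, hk, rfl⟩)) fun j hj _ hx =>
    (gS G T).lie_mem (LieSubalgebra.subset_lieSpan (Or.inl ⟨j, hS hj, rfl⟩)) hx

theorem lie_H_of_mem_upU {h : G.H} (hh : ∀ j ∈ S, G.root j h = 0) {x : g}
    (hx : x ∈ upU G S k) : ⁅(h : g), x⁆ = G.root k h • x := by
  refine upU_induction (Module.End.eigenspace (ad ℂ g (h : g)) (G.root k h))
    (p := fun x => ⁅(h : g), x⁆ = G.root k h • x)
    (fun x => by rw [Module.End.mem_eigenspace_iff, ad_apply]) (G.lie_e h k)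
    (fun j hj x _ h' => ?_) hx
  rw [leibniz_lie, G.lie_e, hh j hj, zero_smul, zero_lie, zero_add, h', lie_smul]

theorem H_mem_stabilizer_upU (h : G.H) : (h : g) ∈ stabilizer (upU G S k) := by
  intro x hx
  refine upU_induction ((upU G S k).comap (ad ℂ g (h : g)))
    (p := fun x => ⁅(h : g), x⁆ ∈ upU G S k) (fun x => Iff.rfl) ?_ (fun j hj x hx h' => ?_) hx
  · rw [G.lie_e]
    exact Submodule.smul_mem _ _ (e_mem_upU G S k)
  · rw [leibniz_lie, G.lie_e, smul_lie]
    exact add_mem (Submodule.smul_mem _ _ (lie_e_mem_upU hj hx)) (lie_e_mem_upU hj h')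

theorem f_mem_stabilizer_upU {i : I} (hi : i ≠ k) : G.f i ∈ stabilizer (upU G S k) := by
  intro x hx
  refine upU_induction ((upU G S k).comap (ad ℂ g (G.f i)))
    (p := fun x => ⁅G.f i, x⁆ ∈ upU G S k) (fun x => Iff.rfl) ?_ (fun j hj x hx h' => ?_) hx
  · rw [← lie_skew, G.e_f, if_neg hi, neg_zero]
    exact zero_mem _
  · rw [leibniz_lie]
    refine add_mem ?_ (lie_e_mem_upU hj h')
    rw [← lie_skew (G.f i), G.e_f, neg_lie]
    refine neg_mem ?_
    split_ifs
    · exact H_mem_stabilizer_upU _ _ hx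
    · rw [zero_lie]; exact zero_mem _

theorem e_lie_downU {l : I} (hkl : k ≠ l) (hk : k ∉ S) {y : g} (hy : y ∈ upU G.swap S l) :
    ⁅G.e k, y⁆ = 0 := by
  refine upU_induction (LinearMap.ker (ad ℂ g (G.e k)))
    (p := fun x => ⁅G.e k, x⁆ = 0) (fun x => Iff.rfl) ?_ (fun j hj x _ h' => ?_) hy
  · exact (G.e_f k l).trans (if_neg hkl.symm)
  · have hjk : j ≠ k := fun h => hk (h ▸ hj)
    rw [leibniz_lie, h', lie_zero, add_zero]
    change ⁅⁅G.e k, G.f j⁆, x⁆ = 0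
    rw [G.e_f, if_neg hjk, zero_lie]

theorem lie_upU_downU {T : Set I} {l : I} (hkl : k ≠ l) (hl : l ∉ S) (hk : k ∉ T) {x y : g}
    (hx : x ∈ upU G S k) (hy : y ∈ upU G.swap T l) : ⁅x, y⁆ = 0 := by
  let W : Submodule ℂ g :=
    { carrier := {x | ∀ y ∈ upU G.swap T l, ⁅x, y⁆ = 0}
      add_mem' := fun ha hb y hy => by rw [add_lie, ha y hy, hb y hy, add_zero]
      zero_mem' := fun y _ => zero_lie y
      smul_mem' := fun c x hx y hy => by rw [smul_lie, hx y hy, smul_zero] }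
  refine upU_le (W := W) (fun y hy => e_lie_downU hkl hk hy) (fun j hj x hx y hy => ?_) hx y hy
  have hjl : j ≠ l := fun h => hl (h ▸ hj)
  have := f_mem_stabilizer_upU (G := G.swap) (S := T) hjl y hy
  rw [lie_lie, hx y hy, hx _ this, lie_zero, sub_zero]

theorem locNil_e (i : I) : LocNil (G.e i) := by
  refine locNil_of_lieSpan G.generates ?_
  rintro y ((hy | ⟨j, rfl⟩) | ⟨j, rfl⟩)
  · refine ⟨2, ?_⟩
    have : ⁅G.e i, y⁆ = -(G.root i ⟨y, hy⟩ • G.e i) := by rw [← lie_skew, ← G.lie_e]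
    simp [pow_succ, this]
  · rcases eq_or_ne i j with rfl | hij
    · exact ⟨1, by simp⟩
    · exact ⟨_, G.serre_e i j hij⟩
  · rcases eq_or_ne j i with rfl | hij
    · refine ⟨3, ?_⟩
      have : ⁅G.e j, (G.coroot j : g)⁆ = -(G.root j (G.coroot j) • G.e j) := by
        rw [← lie_skew, ← G.lie_e]
      simp [pow_succ, G.e_f, this]
    · exact ⟨1, by simp [G.e_f, hij]⟩

variable {h : G.H}

theorem lie_eq_zero_of_eigen_two (ha : A1GradedBy G S (h : g))
    {x y : g} (hxS : x ∈ gS G S) (hx : ⁅(h : g), x⁆ = (2 : ℂ) • x)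
    (hyS : y ∈ gS G S) (hy : ⁅(h : g), y⁆ = (2 : ℂ) • y) : ⁅x, y⁆ = 0 := by
  have h4 : ⁅(h : g), ⁅x, y⁆⁆ = (4 : ℂ) • ⁅x, y⁆ := by
    rw [leibniz_lie, hx, hy, smul_lie, lie_smul, ← add_smul]
    norm_num
  have hm := ha _ ((gS G S).lie_mem hxS hyS)
  generalize ⁅x, y⁆ = z at h4 hm
  obtain ⟨w, hw, c, hc, rfl⟩ := Submodule.mem_sup.1 hm
  obtain ⟨a, ha, b, hb, rfl⟩ := Submodule.mem_sup.1 hw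
  simp only [Module.End.mem_eigenspace_iff, ad_apply] at ha hb hc
  have e1 := h4
  simp only [lie_add, ha, hb, hc] at e1
  have e2 := congrArg (fun z => ⁅(h : g), z⁆) e1
  simp only [lie_add, lie_smul, ha, hb, hc] at e2
  have e3 := congrArg (fun z => ⁅(h : g), z⁆) e2
  simp only [lie_add, lie_smul, ha, hb, hc] at e3
  have hc0 : c = 0 := by linear_combination (norm := module) (1 / 24 : ℂ) • e2 - (1 / 48 : ℂ) • e3
  have hb0 : b = 0 := by linear_combination (norm := module) (-1 / 8 : ℂ) • e2 - (1 / 16 : ℂ) • e3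
  have ha0 : a = 0 := by
    linear_combination (norm := module) (-1 / 4 : ℂ) • e1 - (1 / 2 : ℂ) • hb0 - (3 / 2 : ℂ) • hc0
  rw [ha0, hb0, hc0, add_zero, add_zero]

theorem lie_H_of_mem_upU_diff (hroot : ∀ i ∈ S, G.root i h = if i = k then 2 else 0)
    (hk : k ∈ S) {x : g} (hx : x ∈ upU G (S \ {k}) k) :
    ⁅(h : g), x⁆ = (2 : ℂ) • x := by
  rw [lie_H_of_mem_upU (fun j hj => by rw [hroot j hj.1, if_neg (by exact hj.2)]) hx,
    hroot k hk, if_pos rfl]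

theorem locNil_of_mem_upU (hroot : ∀ i ∈ S, G.root i h = if i = k then 2 else 0)
    (ha : A1GradedBy G S (h : g))
    (hk : k ∈ S) {x : g} (hx : x ∈ upU G (S \ {k}) k) : LocNil x := by
  have hcomm : ∀ x ∈ upU G (S \ {k}) k, ∀ y ∈ upU G (S \ {k}) k, ⁅x, y⁆ = 0 := fun x hx y hy =>
    lie_eq_zero_of_eigen_two ha (upU_le_gS hk Set.sdiff_subset hx)
      (lie_H_of_mem_upU_diff hroot hk hx) (upU_le_gS hk Set.sdiff_subset hy)
      (lie_H_of_mem_upU_diff hroot hk hy)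
  let W : Submodule ℂ g :=
    { carrier := {x | x ∈ upU G (S \ {k}) k ∧ LocNil x}
      add_mem' := fun ha hb => ⟨add_mem ha.1 hb.1, ha.2.add hb.2 (hcomm _ ha.1 _ hb.1)⟩
      zero_mem' := ⟨zero_mem _, LocNil.zero⟩
      smul_mem' := fun c _ ha => ⟨Submodule.smul_mem _ c ha.1, ha.2.smul c⟩ }
  exact (upU_le (W := W) ⟨e_mem_upU G _ k, locNil_e k⟩ (fun j hj x hx =>
    ⟨lie_e_mem_upU hj hx.1,
      LocNil.lie hcomm (locNil_e j) (fun y hy => lie_e_mem_upU hj hy) hx.1 hx.2⟩)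
    hx).2

/-- The subalgebra generated by the Cartan subalgebra and the `e j, f j`, `j ∈ S`. -/
def levi (G : KacMoodyAlgebra A g) (S : Set I) : LieSubalgebra ℂ g :=
  LieSubalgebra.lieSpan ℂ g ((G.H : Set g) ∪ {x | ∃ j ∈ S, x = G.e j} ∪ {x | ∃ j ∈ S, x = G.f j})

theorem levi_swap (G : KacMoodyAlgebra A g) (S : Set I) : levi G.swap S = levi G S := by
  rw [levi, levi, Set.union_assoc, Set.union_comm {x | ∃ j ∈ S, x = G.swap.e j}, ← Set.union_assoc]

theorem H_mem_levi (h : G.H) : (h : g) ∈ levi G S :=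
  LieSubalgebra.subset_lieSpan (Or.inl (Or.inl h.2))

theorem e_mem_levi {j : I} (hj : j ∈ S) : G.e j ∈ levi G S :=
  LieSubalgebra.subset_lieSpan (Or.inl (Or.inr ⟨j, hj, rfl⟩))

theorem f_mem_levi {j : I} (hj : j ∈ S) : G.f j ∈ levi G S :=
  LieSubalgebra.subset_lieSpan (Or.inr ⟨j, hj, rfl⟩)

theorem levi_le_stabilizer_upU (hk : k ∉ S) : levi G S ≤ stabilizer (upU G S k) := by
  refine LieSubalgebra.lieSpan_le.2 ?_
  rintro x ((hx | ⟨j, hj, rfl⟩) | ⟨j, hj, rfl⟩)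
  · exact H_mem_stabilizer_upU ⟨x, hx⟩
  · exact fun x hx => lie_e_mem_upU hj hx
  · exact f_mem_stabilizer_upU fun h => hk (h ▸ hj)

theorem levi_le_stabilizer_downU (hk : k ∉ S) : levi G S ≤ stabilizer (upU G.swap S k) :=
  levi_swap G S ▸ levi_le_stabilizer_upU hk

theorem lie_H_of_mem_levi {h : G.H} (hh : ∀ j ∈ S, G.root j h = 0) {x : g} (hx : x ∈ levi G S) :
    ⁅(h : g), x⁆ = 0 := by
  induction hx using LieSubalgebra.lieSpan_induction with
  | mem x hx =>
    obtain ((hx | ⟨j, hj, rfl⟩) | ⟨j, hj, rfl⟩) := hx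
    · exact G.abelian h ⟨x, hx⟩
    · rw [G.lie_e, hh j hj, zero_smul]
    · rw [G.lie_f, hh j hj, neg_zero, zero_smul]
  | zero => exact lie_zero _
  | add x y _ _ hx hy => rw [lie_add, hx, hy, add_zero]
  | smul c x _ hx => rw [lie_smul, hx, smul_zero]
  | lie x y _ _ hx hy => rw [leibniz_lie, hx, hy, zero_lie, lie_zero, add_zero]

theorem e_lie_downU_mem_levi (hk : k ∉ S) {y : g} (hy : y ∈ upU G.swap S k) :
    ⁅G.e k, y⁆ ∈ levi G S := by
  refine upU_induction ((levi G S).toSubmodule.comap (ad ℂ g (G.e k)))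
    (p := fun x => ⁅G.e k, x⁆ ∈ levi G S) (fun x => Iff.rfl) ?_ (fun j hj x _ h' => ?_) hy
  · change ⁅G.e k, G.f k⁆ ∈ _
    rw [G.e_f, if_pos rfl]
    exact H_mem_levi _
  · have hjk : j ≠ k := fun h => hk (h ▸ hj)
    rw [leibniz_lie]
    change ⁅⁅G.e k, G.f j⁆, x⁆ + ⁅G.f j, _⁆ ∈ _
    rw [G.e_f, if_neg hjk, zero_lie, zero_add]
    exact (levi G S).lie_mem (f_mem_levi hj) h'

theorem e_mem_stabilizer_triangular (hroot : ∀ i ∈ S, G.root i h = if i = k then 2 else 0)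
    (ha : A1GradedBy G S (h : g))
    (hk : k ∈ S) : G.e k ∈ stabilizer
    (upU G.swap (S \ {k}) k ⊔ (levi G (S \ {k})).toSubmodule ⊔ upU G (S \ {k}) k) := by
  have hk' : k ∉ S \ {k} := fun h => h.2 rfl
  intro w hw
  obtain ⟨v, hv, c, hc, rfl⟩ := Submodule.mem_sup.1 hw
  obtain ⟨a, ha', b, hb, rfl⟩ := Submodule.mem_sup.1 hv
  rw [lie_add, lie_add]
  refine add_mem (add_mem ?_ ?_) ?_
  · exact Submodule.mem_sup_left (Submodule.mem_sup_right (e_lie_downU_mem_levi hk' ha'))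
  · refine Submodule.mem_sup_right ?_
    rw [← lie_skew]
    exact neg_mem (levi_le_stabilizer_upU hk' hb _ (e_mem_upU G _ k))
  · have he := e_mem_upU G (S \ {k}) k
    rw [lie_eq_zero_of_eigen_two ha (upU_le_gS hk Set.sdiff_subset he)
      (lie_H_of_mem_upU_diff hroot hk he) (upU_le_gS hk Set.sdiff_subset hc)
      (lie_H_of_mem_upU_diff hroot hk hc)]
    exact zero_mem _

theorem levi_le_stabilizer_triangular (hk : k ∉ S) : levi G S ≤ stabilizer
    (upU G.swap S k ⊔ (levi G S).toSubmodule ⊔ upU G S k) := by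
  intro x hx w hw
  obtain ⟨v, hv, c, hc, rfl⟩ := Submodule.mem_sup.1 hw
  obtain ⟨a, ha', b, hb, rfl⟩ := Submodule.mem_sup.1 hv
  rw [lie_add, lie_add]
  exact add_mem (add_mem
    (Submodule.mem_sup_left (Submodule.mem_sup_left (levi_le_stabilizer_downU hk hx _ ha')))
    (Submodule.mem_sup_left (Submodule.mem_sup_right ((levi G S).lie_mem hx hb))))
    (Submodule.mem_sup_right (levi_le_stabilizer_upU hk hx _ hc))

theorem gS_le_triangular (hroot : ∀ i ∈ S, G.root i h = if i = k then 2 else 0)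
    (ha : A1GradedBy G S (h : g))
    (hk : k ∈ S) : (gS G S).toSubmodule ≤
    upU G.swap (S \ {k}) k ⊔ (levi G (S \ {k})).toSubmodule ⊔ upU G (S \ {k}) k := by
  have hk' : k ∉ S \ {k} := fun h => h.2 rfl
  refine lieSpan_le_of_stabilizer ?_ ?_
  · rintro x (⟨j, hj, rfl⟩ | ⟨j, hj, rfl⟩)
    · by_cases hjk : j = k
      · subst hjk; exact Submodule.mem_sup_right (e_mem_upU G _ _)
      · exact Submodule.mem_sup_left (Submodule.mem_sup_right (e_mem_levi ⟨hj, hjk⟩))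
    · by_cases hjk : j = k
      · subst hjk
        exact Submodule.mem_sup_left (Submodule.mem_sup_left (e_mem_upU G.swap _ _))
      · exact Submodule.mem_sup_left (Submodule.mem_sup_right (f_mem_levi ⟨hj, hjk⟩))
  · rintro x (⟨j, hj, rfl⟩ | ⟨j, hj, rfl⟩)
    · by_cases hjk : j = k
      · subst hjk; exact e_mem_stabilizer_triangular hroot ha hj
      · exact levi_le_stabilizer_triangular hk' (e_mem_levi ⟨hj, hjk⟩)
    · by_cases hjk : j = k
      · subst hjk
        have := e_mem_stabilizer_triangular (G := G.swap) (h := -h) (k := j) (S := S)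
          (fun i hi => by simpa using hroot i hi) (by simpa using ha.swap) hj
        rw [levi_swap] at this
        rw [sup_assoc, sup_comm, sup_comm (levi G _).toSubmodule]
        exact this
      · exact levi_le_stabilizer_triangular hk' (f_mem_levi ⟨hj, hjk⟩)

theorem mem_upU_of_eigen_two (hroot : ∀ i ∈ S, G.root i h = if i = k then 2 else 0)
    (ha : A1GradedBy G S (h : g))
    (hk : k ∈ S) {x : g} (hxS : x ∈ gS G S)
    (hx : ⁅(h : g), x⁆ = (2 : ℂ) • x) : x ∈ upU G (S \ {k}) k := by
  obtain ⟨v, hv, c, hc, rfl⟩ := Submodule.mem_sup.1 (gS_le_triangular hroot ha hk hxS)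
  obtain ⟨a, ha', b, hb, rfl⟩ := Submodule.mem_sup.1 hv
  have ta : ⁅(h : g), a⁆ = (-2 : ℂ) • a := by
    have := lie_H_of_mem_upU_diff (G := G.swap) (h := -h) (k := k) (S := S)
      (fun i hi => by simpa using hroot i hi) hk ha'
    rw [neg_smul, ← this]
    simp
  have tb : ⁅(h : g), b⁆ = 0 := lie_H_of_mem_levi (fun j hj => by
    rw [hroot j hj.1, if_neg (by exact hj.2)]) hb
  have tc := lie_H_of_mem_upU_diff hroot hk hc
  simp only [lie_add, ta, tb, tc] at hx
  have e2 := congrArg (fun z => ⁅(h : g), z⁆) hx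
  simp only [lie_add, lie_smul, ta, tb, tc, lie_zero] at e2
  have : a + b + c = c := by
    linear_combination (norm := module) (-1 / 2 : ℂ) • hx - (1 / 8 : ℂ) • e2
  rwa [this]

end PositivePart

/-! ### The generators attached to a `C`-admissible pair -/

section CAdmissible

open LieAlgebra

theorem self_mem_cmpnt {I : Type*} (A : Matrix I I ℤ) (J : Set I) (k : I) :
    k ∈ cmpnt A (J ∪ {k}) k :=
  ⟨Or.inr rfl, Relation.ReflTransGen.refl⟩

theorem cmpnt_diff_subset {I : Type*} (A : Matrix I I ℤ) (J : Set I) (k : I) :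
    cmpnt A (J ∪ {k}) k \ {k} ⊆ J := fun _ hi => hi.1.1.resolve_right hi.2

theorem apply_eq_zero_of_notMem_cmpnt {I : Type*} {A : Matrix I I ℤ} {S : Set I} {k i j : I}
    (hi : i ∈ cmpnt A S k) (hj : j ∈ S) (hj' : j ∉ cmpnt A S k) : A i j = 0 := by
  by_contra h
  exact hj' ⟨hj, hi.2.tail ⟨hi.1, hj, h⟩⟩

theorem notMem_cmpnt_diff {I : Type*} {A : Matrix I I ℤ} {J : Set I} (k l : {k : I // k ∉ J}) :
    l.1 ∉ cmpnt A (J ∪ {k.1}) k.1 \ {k.1} :=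
  fun h => l.2 (cmpnt_diff_subset A J k.1 h)

variable {I : Type*} [Fintype I] [DecidableEq I] {A : Matrix I I ℤ}
variable {g : Type*} [LieRing g] [LieAlgebra ℂ g]

theorem mem_hJsub {G : KacMoodyAlgebra A g} {J : Set I} {h : G.H} :
    h ∈ hJsub G J ↔ ∀ j ∈ J, G.root j h = 0 := by
  simp [hJsub]

/-- An `sl₂`-triple with locally nilpotent nilpositive part acts on a lowest weight vector with
the expected order of nilpotency. -/
theorem ad_pow_eq_zero_of_lowest {h e f v : g} (t : IsSl2Triple h e f) (he : LocNil e) {a : ℤ}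
    (hv : ⁅h, v⁆ = (a : ℂ) • v) (hf : ⁅f, v⁆ = 0) : ((ad ℂ g e) ^ (1 - a).toNat) v = 0 := by
  rcases eq_or_ne v 0 with rfl | hv0
  · rw [map_zero]
  have P : IsSl2Triple.HasPrimitiveVectorWith t.symm v (-a : ℂ) :=
    ⟨hv0, by rw [neg_lie, hv, neg_smul], hf⟩
  have hspec := Nat.find_spec (he v)
  have hmin := fun m => Nat.find_min (he v) (m := m)
  obtain ⟨n, hn⟩ : ∃ n, Nat.find (he v) = n + 1 := by
    refine Nat.exists_eq_succ_of_ne_zero fun h0 => hv0 ?_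
    rw [h0] at hspec
    simpa using hspec
  rw [hn] at hspec hmin
  have h1 := P.lie_e_pow_succ_toEnd_f n
  have h2 : (LieModule.toEnd ℂ g g e ^ (n + 1)) v = 0 := hspec
  rw [h2, lie_zero] at h1
  have h3 := (smul_eq_zero.1 h1.symm).resolve_right (hmin n (Nat.lt_succ_self n))
  have h4 : (n : ℂ) + 1 ≠ 0 := by exact_mod_cast Nat.succ_ne_zero n
  have h5 : (-a : ℤ) = n := by
    have := (mul_eq_zero.1 h3).resolve_left h4
    exact_mod_cast sub_eq_zero.1 this
  rw [show (1 - a).toNat = n + 1 by omega]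
  exact hspec

namespace CAdmissibleData

variable {G : KacMoodyAlgebra A g} {J : Set I} (D : CAdmissibleData G J)

theorem E_mem_upU (k : {k : I // k ∉ J}) :
    D.E k ∈ upU G (cmpnt A (J ∪ {k.1}) k.1 \ {k.1}) k.1 :=
  mem_upU_of_eigen_two (D.isHGen k).2 (D.a1 k) (self_mem_cmpnt A J k.1) (D.memE k)
    ((D.sl2 k).lie_h_e_smul ℂ)

theorem F_mem_downU (k : {k : I // k ∉ J}) :
    D.F k ∈ upU G.swap (cmpnt A (J ∪ {k.1}) k.1 \ {k.1}) k.1 := D.swap.E_mem_upU k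

theorem locNil_E (k : {k : I // k ∉ J}) : LocNil (D.E k) :=
  locNil_of_mem_upU (D.isHGen k).2 (D.a1 k) (self_mem_cmpnt A J k.1) (D.E_mem_upU k)

theorem lie_E_F_of_ne {k l : {k : I // k ∉ J}} (h : k ≠ l) : ⁅D.E k, D.F l⁆ = 0 :=
  lie_upU_downU (fun h' => h (Subtype.ext h')) (notMem_cmpnt_diff k l) (notMem_cmpnt_diff l k)
    (D.E_mem_upU k) (D.F_mem_downU l)

theorem Hc_mem_hJsub (k : {k : I // k ∉ J}) : D.Hc k ∈ hJsub G J := by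
  rw [mem_hJsub]
  intro j hj
  by_cases h : j ∈ cmpnt A (J ∪ {k.1}) k.1
  · rw [(D.isHGen k).2 j h, if_neg]
    rintro rfl
    exact k.2 hj
  · have hle : Submodule.span ℂ (G.coroot '' cmpnt A (J ∪ {k.1}) k.1) ≤
        LinearMap.ker (G.root j) := by
      rw [Submodule.span_le]
      rintro _ ⟨i, hi, rfl⟩
      simp [G.pairing, apply_eq_zero_of_notMem_cmpnt hi (Or.inl hj) h]
    exact hle (D.isHGen k).1

theorem lie_hJ_E {h : G.H} (hh : h ∈ hJsub G J) (k : {k : I // k ∉ J}) :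
    ⁅(h : g), D.E k⁆ = G.root k.1 h • D.E k :=
  lie_H_of_mem_upU (fun j hj => mem_hJsub.1 hh j (cmpnt_diff_subset A J k.1 hj)) (D.E_mem_upU k)

theorem lie_hJ_F {h : G.H} (hh : h ∈ hJsub G J) (k : {k : I // k ∉ J}) :
    ⁅(h : g), D.F k⁆ = -(G.root k.1 h) • D.F k :=
  D.swap.lie_hJ_E (by rwa [hJsub_swap]) k

theorem serre_E {A' : Matrix {k : I // k ∉ J} {k : I // k ∉ J} ℤ}
    (hA' : ∀ k l, (A' k l : ℂ) = G.root l.1 (D.Hc k)) {k l : {k : I // k ∉ J}} (h : k ≠ l) :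
    ((ad ℂ g (D.E k)) ^ (1 - A' k l).toNat) (D.E l) = 0 := by
  refine ad_pow_eq_zero_of_lowest (D.sl2 k) (D.locNil_E k) ?_ ?_
  · rw [hA', D.lie_hJ_E (D.Hc_mem_hJsub k)]
  · rw [← lie_skew, D.lie_E_F_of_ne h.symm, neg_zero]

theorem serre_F {A' : Matrix {k : I // k ∉ J} {k : I // k ∉ J} ℤ}
    (hA' : ∀ k l, (A' k l : ℂ) = G.root l.1 (D.Hc k)) {k l : {k : I // k ∉ J}} (h : k ≠ l) :
    ((ad ℂ g (D.F k)) ^ (1 - A' k l).toNat) (D.F l) = 0 :=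
  D.swap.serre_E (fun k l => by simp [hA']) h

end CAdmissibleData

end CAdmissible

/-! ### Weight decomposition of a Lie algebra with Chevalley-type generators -/

section WeightDecomposition

open LieAlgebra

variable {K L : Type*} [LieRing L] [LieAlgebra ℂ L]

/-- The subalgebra generated by the `e i`, as the smallest subspace containing the `e i` and
stable under them. -/
def posPart (e : K → L) : Submodule ℂ L :=
  sInf {W | (∀ i, e i ∈ W) ∧ ∀ i, ∀ x ∈ W, ⁅e i, x⁆ ∈ W}

variable {e f : K → L} {H : Submodule ℂ L}

theorem mem_posPart (i : K) : e i ∈ posPart e := by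
  simp only [posPart, Submodule.mem_sInf]
  exact fun W hW => hW.1 i

theorem lie_mem_posPart (i : K) {x : L} (hx : x ∈ posPart e) : ⁅e i, x⁆ ∈ posPart e := by
  simp only [posPart, Submodule.mem_sInf] at hx ⊢
  exact fun W hW => hW.2 i x (hx W hW)

theorem posPart_le {W : Submodule ℂ L} (h₁ : ∀ i, e i ∈ W)
    (h₂ : ∀ i, ∀ x ∈ posPart e, x ∈ W → ⁅e i, x⁆ ∈ W) : posPart e ≤ W := by
  have : posPart e ≤ W ⊓ posPart e := sInf_le ⟨fun i => ⟨h₁ i, mem_posPart i⟩,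
    fun i x hx => ⟨h₂ i x hx.2 hx.1, lie_mem_posPart i hx.2⟩⟩
  exact this.trans inf_le_left

theorem mem_stabilizer_posPart {x : L} (h : ∀ i, ∃ c : ℂ, ⁅x, e i⁆ = c • e i) :
    x ∈ stabilizer (posPart e) := by
  refine posPart_le (W := (posPart e).comap (ad ℂ L x)) (fun i => ?_) fun i y hy hxy => ?_
  · obtain ⟨c, hc⟩ := h i
    change ⁅x, e i⁆ ∈ posPart e
    rw [hc]
    exact Submodule.smul_mem _ _ (mem_posPart i)
  · obtain ⟨c, hc⟩ := h i
    change ⁅x, ⁅e i, y⁆⁆ ∈ posPart e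
    rw [leibniz_lie, hc, smul_lie]
    exact add_mem (Submodule.smul_mem _ _ (lie_mem_posPart i hy)) (lie_mem_posPart i hxy)

theorem lie_posPart_mem (he : ∀ x ∈ H, ∀ i, ∃ c : ℂ, ⁅x, e i⁆ = c • e i) {y : L}
    (hy : ∀ i, ⁅y, e i⁆ ∈ H) {x : L} (hx : x ∈ posPart e) : ⁅y, x⁆ ∈ posPart e ⊔ H := by
  refine posPart_le (W := (posPart e ⊔ H).comap (ad ℂ L y))
    (fun i => Submodule.mem_sup_right (hy i)) (fun i x hx hyx => ?_) hx
  change ⁅y, ⁅e i, x⁆⁆ ∈ posPart e ⊔ H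
  rw [leibniz_lie]
  refine Submodule.mem_sup_left (add_mem (mem_stabilizer_posPart (he _ (hy i)) _ hx) ?_)
  obtain ⟨a, ha, b, hb, hab⟩ := Submodule.mem_sup.1 (show ⁅y, x⁆ ∈ posPart e ⊔ H from hyx)
  obtain ⟨c, hc⟩ := he b hb i
  rw [← hab, lie_add, ← lie_skew (e i) b, hc]
  exact add_mem (lie_mem_posPart i ha) (neg_mem (Submodule.smul_mem _ _ (mem_posPart i)))

theorem posPart_le_iSup_eigenspace {h : L} {c : ℂ} (hc : ∀ i, ⁅h, e i⁆ = c • e i) (hc0 : c ≠ 0) :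
    posPart e ≤ ⨆ (μ : ℂ) (_ : μ ≠ 0), Module.End.eigenspace (ad ℂ L h) μ := by
  have key : posPart e ≤ ⨆ n : ℕ, Module.End.eigenspace (ad ℂ L h) ((n + 1 : ℕ) * c) := by
    refine posPart_le (fun i => ?_) fun i x hxe hx => ?_
    · refine Submodule.mem_iSup_of_mem 0 ?_
      rw [Module.End.mem_eigenspace_iff]
      simpa using hc i
    · clear hxe
      induction hx using Submodule.iSup_induction' with
      | mem n x hx =>
        refine Submodule.mem_iSup_of_mem (n + 1) ?_
        rw [Module.End.mem_eigenspace_iff, ad_apply] at hx ⊢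
        rw [leibniz_lie, hc, hx, smul_lie, lie_smul, ← add_smul]
        congr 1
        push_cast
        ring
      | zero => rw [lie_zero]; exact zero_mem _
      | add x y _ _ hx hy => rw [lie_add]; exact add_mem hx hy
  refine key.trans (iSup_le fun n => ?_)
  exact le_iSup₂_of_le ((n + 1 : ℕ) * c)
    (mul_ne_zero (by exact_mod_cast Nat.succ_ne_zero n) hc0) le_rfl

theorem posPart_sup_negPart_eq_top (habel : ∀ x ∈ H, ∀ y ∈ H, ⁅x, y⁆ = 0)
    (he : ∀ x ∈ H, ∀ i, ∃ c : ℂ, ⁅x, e i⁆ = c • e i)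
    (hf : ∀ x ∈ H, ∀ i, ∃ c : ℂ, ⁅x, f i⁆ = c • f i) (hef : ∀ i j, ⁅e i, f j⁆ ∈ H)
    (hgen : LieSubalgebra.lieSpan ℂ L ((H : Set L) ∪ Set.range e ∪ Set.range f) = ⊤) :
    posPart f ⊔ H ⊔ posPart e = ⊤ := by
  have aux : ∀ {e f : K → L}, (∀ x ∈ H, ∀ i, ∃ c : ℂ, ⁅x, e i⁆ = c • e i) →
      (∀ x ∈ H, ∀ i, ∃ c : ℂ, ⁅x, f i⁆ = c • f i) → (∀ i j, ⁅e i, f j⁆ ∈ H) →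
      ∀ i, e i ∈ stabilizer (posPart f ⊔ H ⊔ posPart e) := by
    intro e f he hf hef i w hw
    obtain ⟨v, hv, c, hc, rfl⟩ := Submodule.mem_sup.1 hw
    obtain ⟨a, ha, b, hb, rfl⟩ := Submodule.mem_sup.1 hv
    rw [lie_add, lie_add]
    refine add_mem (add_mem ?_ ?_) (Submodule.mem_sup_right (lie_mem_posPart i hc))
    · exact Submodule.mem_sup_left (lie_posPart_mem hf (hef i) ha)
    · obtain ⟨c, hc⟩ := he b hb i
      rw [← lie_skew, hc]
      exact Submodule.mem_sup_right (neg_mem (Submodule.smul_mem _ _ (mem_posPart i)))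
  have hfe : ∀ i j, ⁅f i, e j⁆ ∈ H := fun i j => by
    rw [← lie_skew]; exact neg_mem (hef j i)
  rw [eq_top_iff, ← LieSubalgebra.top_toSubmodule (R := ℂ) (L := L), ← hgen]
  refine lieSpan_le_of_stabilizer ?_ ?_
  · rintro x ((hx | ⟨j, rfl⟩) | ⟨j, rfl⟩)
    · exact Submodule.mem_sup_left (Submodule.mem_sup_right hx)
    · exact Submodule.mem_sup_right (mem_posPart j)
    · exact Submodule.mem_sup_left (Submodule.mem_sup_left (mem_posPart j))
  · rintro x ((hx | ⟨j, rfl⟩) | ⟨j, rfl⟩)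
    · intro w hw
      obtain ⟨v, hv, c, hc, rfl⟩ := Submodule.mem_sup.1 hw
      obtain ⟨a, ha, b, hb, rfl⟩ := Submodule.mem_sup.1 hv
      rw [lie_add, lie_add, habel x hx b hb, add_zero]
      exact add_mem
        (Submodule.mem_sup_left (Submodule.mem_sup_left (mem_stabilizer_posPart (hf x hx) _ ha)))
        (Submodule.mem_sup_right (mem_stabilizer_posPart (he x hx) _ hc))
    · exact aux he hf hef j
    · rw [sup_assoc, sup_comm, sup_comm H]
      exact aux hf he hfe j

theorem exists_apply_eq {V : Type*} [AddCommGroup V] [Module ℂ V] [FiniteDimensional ℂ V]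
    {φ : K → Module.Dual ℂ V} (h : LinearIndependent ℂ φ) (c : K → ℂ) :
    ∃ v : V, ∀ i, φ i v = c i := by
  obtain ⟨ψ, hψ⟩ := LinearMap.exists_extend ((Module.Basis.span h).constr ℂ c)
  refine ⟨(Module.evalEquiv ℂ V).symm ψ, fun i => ?_⟩
  have h1 : ψ (φ i) = c i := by
    have := LinearMap.congr_fun hψ (Module.Basis.span h i)
    rw [Module.Basis.constr_basis, LinearMap.comp_apply, Submodule.subtype_apply,
      Module.Basis.span_apply] at this
    exact this
  rw [← h1]
  exact Module.apply_evalEquiv_symm_apply ℂ V (φ i) ψ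

variable {root : K → Module.Dual ℂ H}

theorem wtSpaceι_zero_eq [FiniteDimensional ℂ H] (hroot : LinearIndependent ℂ root)
    (habel : ∀ x y : H, ⁅(x : L), (y : L)⁆ = 0)
    (he : ∀ (x : H) i, ⁅(x : L), e i⁆ = root i x • e i)
    (hf : ∀ (x : H) i, ⁅(x : L), f i⁆ = -(root i x) • f i) (hef : ∀ i j, ⁅e i, f j⁆ ∈ H)
    (hgen : LieSubalgebra.lieSpan ℂ L ((H : Set L) ∪ Set.range e ∪ Set.range f) = ⊤) :
    wtSpaceι H.subtype (0 : Module.Dual ℂ H) = H := by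
  refine le_antisymm (fun x hx => ?_) fun x hx v => ?_
  · obtain ⟨h, hh⟩ := exists_apply_eq hroot fun _ => 1
    have htop := posPart_sup_negPart_eq_top (e := e) (f := f)
      (fun x hx y hy => habel ⟨x, hx⟩ ⟨y, hy⟩)
      (fun x hx i => ⟨_, he ⟨x, hx⟩ i⟩) (fun x hx i => ⟨_, hf ⟨x, hx⟩ i⟩) hef hgen
    obtain ⟨v, hv, c, hc, hxc⟩ := Submodule.mem_sup.1 (htop ▸ Submodule.mem_top : x ∈ _)
    obtain ⟨a, ha, b, hb, rfl⟩ := Submodule.mem_sup.1 hv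
    have hc' := posPart_le_iSup_eigenspace (h := (h : L)) (c := 1)
      (fun i => by rw [he, hh]) one_ne_zero hc
    have ha' := posPart_le_iSup_eigenspace (h := (h : L)) (c := -1)
      (fun i => by rw [hf, hh]) (neg_ne_zero.2 one_ne_zero) ha
    have h0 : x - b ∈ Module.End.eigenspace (ad ℂ L (h : L)) 0 := by
      rw [Module.End.mem_eigenspace_iff, ad_apply, lie_sub, habel h ⟨b, hb⟩, sub_zero]
      exact (hx h).trans ((zero_smul ℂ x).trans (zero_smul ℂ (x - b)).symm)
    have h1 : x - b = a + c := by rw [← hxc]; abel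
    have h2 : x - b = 0 := by
      refine Submodule.disjoint_def.1
        (Module.End.eigenspaces_iSupIndep (ad ℂ L (h : L)) 0) _ h0 ?_
      rw [h1]
      exact add_mem ha' hc'
    rw [sub_eq_zero.1 h2]
    exact hb
  · simpa using habel v ⟨x, hx⟩

theorem lie_mem_wtSpaceι {χ ψ : Module.Dual ℂ H} {x y : L} (hx : x ∈ wtSpaceι H.subtype χ)
    (hy : y ∈ wtSpaceι H.subtype ψ) : ⁅x, y⁆ ∈ wtSpaceι H.subtype (χ + ψ) := fun v => by
  rw [leibniz_lie, hx v, hy v, smul_lie, lie_smul, ← add_smul, LinearMap.add_apply]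

theorem iSup_wtSpaceι_eq_top (habel : ∀ x y : H, ⁅(x : L), (y : L)⁆ = 0)
    (he : ∀ (x : H) i, ⁅(x : L), e i⁆ = root i x • e i)
    (hf : ∀ (x : H) i, ⁅(x : L), f i⁆ = -(root i x) • f i)
    (hgen : LieSubalgebra.lieSpan ℂ L ((H : Set L) ∪ Set.range e ∪ Set.range f) = ⊤) :
    ⨆ χ : Module.Dual ℂ H, wtSpaceι H.subtype χ = ⊤ := by
  have hmem : ∀ x ∈ (H : Set L) ∪ Set.range e ∪ Set.range f,
      ∃ χ : Module.Dual ℂ H, x ∈ wtSpaceι H.subtype χ := by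
    rintro x ((hx | ⟨j, rfl⟩) | ⟨j, rfl⟩)
    · exact ⟨0, fun v => by simpa using habel v ⟨x, hx⟩⟩
    · exact ⟨root j, fun v => he v j⟩
    · exact ⟨-root j, fun v => hf v j⟩
  rw [eq_top_iff, ← LieSubalgebra.top_toSubmodule (R := ℂ) (L := L), ← hgen]
  refine lieSpan_le_of_stabilizer (fun x hx => ?_) fun x hx w hw => ?_
  · obtain ⟨χ, hχ⟩ := hmem x hx
    exact Submodule.mem_iSup_of_mem χ hχ
  · obtain ⟨χ, hχ⟩ := hmem x hx
    induction hw using Submodule.iSup_induction' with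
    | mem ψ y hy => exact Submodule.mem_iSup_of_mem (χ + ψ) (lie_mem_wtSpaceι hχ hy)
    | zero => rw [lie_zero]; exact zero_mem _
    | add y z _ _ hy hz => rw [lie_add]; exact add_mem hy hz

end WeightDecomposition

/-! ### Rank and corank of integer matrices -/

section Corank

open Matrix

theorem rank_map_ratCast {m : Type*} [Fintype m] [DecidableEq m] (M : Matrix m m ℚ) :
    (M.map ((↑) : ℚ → ℂ)).rank = M.rank := by
  obtain ⟨V, U, e, hV, hU, h⟩ := M.exists_rank_normal_form
  have hmap := congrArg (Rat.castHom ℂ).mapMatrix h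
  rw [map_mul, map_mul] at hmap
  have hV' := (hV.map (Rat.castHom ℂ).mapMatrix)
  have hU' := (hU.map (Rat.castHom ℂ).mapMatrix)
  rw [isUnit_iff_isUnit_det] at hV' hU'
  have h1 : (Rat.castHom ℂ).mapMatrix M = M.map ((↑) : ℚ → ℂ) := rfl
  rw [← h1, ← rank_mul_eq_right_of_isUnit_det _ _ hV', ← rank_mul_eq_left_of_isUnit_det _ _ hU',
    hmap]
  have h2 : (Rat.castHom ℂ).mapMatrix ((fromBlocks 1 0 0 0).submatrix e e) =
      ((fromBlocks 1 0 0 0 : Matrix (Fin M.rank ⊕ Fin (Fintype.card m - M.rank)) _ ℂ)).submatrix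
        e e := by
    ext i j
    rcases hi : e i with a | a <;> rcases hj : e j with b | b <;>
      simp [hi, hj, Matrix.one_apply, apply_ite (Rat.cast : ℚ → ℂ)]
  rw [h2, rank_submatrix]
  have h3 : (fromBlocks 1 0 0 0 : Matrix (Fin M.rank ⊕ Fin (Fintype.card m - M.rank)) _ ℂ) =
      diagonal (Sum.elim (fun _ => 1) fun _ => 0) := by
    rw [← diagonal_one, ← diagonal_zero, fromBlocks_diagonal]
  rw [h3, rank_diagonal]
  rw [Fintype.card_congr (Equiv.subtypeSum ..)]
  simp

theorem gcmCorank_eq_finrank {ι M : Type*} [Fintype ι] [DecidableEq ι] [AddCommGroup M]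
    [Module ℂ M] (A : Matrix ι ι ℤ) {v : ι → M} (hv : LinearIndependent ℂ v)
    {φ : ι → Module.Dual ℂ M} (hφ : ∀ i j, φ j (v i) = (A i j : ℂ)) :
    gcmCorank A = Module.finrank ℂ
      ↥(Submodule.span ℂ (Set.range v) ⊓ ⨅ j, LinearMap.ker (φ j)) := by
  set B : Matrix ι ι ℂ := A.map ((↑) : ℤ → ℂ) with hB
  have hrank : (A.map ((↑) : ℤ → ℚ)).rank = Bᵀ.rank := by
    rw [rank_transpose, ← rank_map_ratCast]
    simp [hB, Function.comp_def]
  have hinj : Function.Injective (Fintype.linearCombination ℂ v) :=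
    hv.fintypeLinearCombination_injective
  have hker : Submodule.span ℂ (Set.range v) ⊓ ⨅ j, LinearMap.ker (φ j) =
      (LinearMap.ker Bᵀ.mulVecLin).map (Fintype.linearCombination ℂ v) := by
    have key : ∀ c j, φ j (Fintype.linearCombination ℂ v c) = (Bᵀ *ᵥ c) j := fun c j => by
      simp [Fintype.linearCombination_apply, Matrix.mulVec, dotProduct, hφ, hB, mul_comm]
    ext x
    rw [← Fintype.range_linearCombination]
    simp only [Submodule.mem_inf, LinearMap.mem_range, Submodule.mem_iInf, LinearMap.mem_ker,
      Submodule.mem_map, mulVecLin_apply, funext_iff, ← key, Pi.zero_apply]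
    constructor
    · rintro ⟨⟨c, rfl⟩, h⟩
      exact ⟨c, h, rfl⟩
    · rintro ⟨c, h, rfl⟩
      exact ⟨⟨c, rfl⟩, h⟩
  have h1 := LinearMap.finrank_range_add_finrank_ker Bᵀ.mulVecLin
  rw [Module.finrank_fintype_fun_eq_card] at h1
  rw [gcmCorank, hker, hrank,
    ← (Submodule.equivMapOfInjective _ hinj (LinearMap.ker Bᵀ.mulVecLin)).finrank_eq, Matrix.rank]
  omega

theorem IsFiniteType.det_ne_zero {ι : Type*} [Fintype ι] [DecidableEq ι] {A : Matrix ι ι ℤ}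
    (hA : IsFiniteType A) (hdiag : ∀ i, 0 ≤ A i i) (hoff : ∀ i j, i ≠ j → A i j ≤ 0) :
    (A.map ((↑) : ℤ → ℂ)).det ≠ 0 := by
  obtain ⟨u, hu, h⟩ := hA
  have hB : (of fun i j => (u j : ℂ) * (A.map ((↑) : ℤ → ℂ)) i j).det ≠ 0 := by
    refine det_ne_zero_of_sum_row_lt_diag fun k => ?_
    have hn : ∀ q : ℚ, ‖(q : ℂ)‖ = |(q : ℝ)| := fun q => by
      rw [← Complex.ofReal_ratCast, Complex.norm_real, Real.norm_eq_abs]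
    have hterm : ∀ i j, ‖of (fun i j => (u j : ℂ) * (A.map ((↑) : ℤ → ℂ)) i j) i j‖ =
        ((|(A i j : ℚ) * u j| : ℚ) : ℝ) := fun i j => by
      rw [Rat.cast_abs, ← hn]
      simp [mul_comm]
    simp only [hterm]
    rw [← Rat.cast_sum, Rat.cast_lt]
    have hk := h k
    rw [finsum_eq_sum_of_fintype, ← Finset.add_sum_erase _ _ (Finset.mem_univ k)] at hk
    have h1 : |(A k k : ℚ) * u k| = A k k * u k :=
      abs_of_nonneg (mul_nonneg (by exact_mod_cast hdiag k) (hu k).le)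
    have h2 : ∑ j ∈ Finset.univ.erase k, |(A k j : ℚ) * u j| =
        -∑ j ∈ Finset.univ.erase k, (A k j : ℚ) * u j := by
      rw [← Finset.sum_neg_distrib]
      refine Finset.sum_congr rfl fun j hj => abs_of_nonpos ?_
      exact mul_nonpos_of_nonpos_of_nonneg
        (by exact_mod_cast hoff k j (Finset.ne_of_mem_erase hj).symm) (hu j).le
    rw [h1, h2]
    linarith
  rw [det_mul_row] at hB
  exact right_ne_zero_of_mul hB

end Corank

/-! ### The Cartan subalgebra `h^J` -/

section Cartan

variable {I : Type*} [Fintype I] [DecidableEq I] {A : Matrix I I ℤ}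
variable {g : Type*} [LieRing g] [LieAlgebra ℂ g] {G : KacMoodyAlgebra A g} {J : Set I}

theorem disjoint_span_coroot_hJsub (hGCM : IsGCM A) (hJ : IsFiniteType (restrictM A J)) :
    Disjoint (Submodule.span ℂ (G.coroot '' J)) (hJsub G J) := by
  refine Submodule.disjoint_def.2 fun y hy hy' => ?_
  have hdet := hJ.det_ne_zero (fun i => by simp [restrictM, hGCM.1])
    fun i j hij => hGCM.2.1 i j fun h => hij (Subtype.ext h)
  rw [Set.image_eq_range, Submodule.mem_span_range_iff_exists_fun] at hy
  obtain ⟨c, rfl⟩ := hy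
  rw [mem_hJsub] at hy'
  have hc : c = 0 := by
    refine Matrix.eq_zero_of_vecMul_eq_zero hdet (funext fun j => ?_)
    simpa [Matrix.vecMul, dotProduct, G.pairing, restrictM] using hy' j j.2
  simp [hc]

theorem finrank_hJsub_add_card (G : KacMoodyAlgebra A g) (J : Set I) :
    Module.finrank ℂ (hJsub G J) + Fintype.card J = Module.finrank ℂ G.H := by
  have := G.findimH
  let T : G.H →ₗ[ℂ] J → ℂ := LinearMap.pi fun j => G.root j
  have hT : LinearMap.range T = ⊤ := by
    refine LinearMap.range_eq_top.2 fun c => ?_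
    obtain ⟨v, hv⟩ := exists_apply_eq (G.indepRoot.comp _ Subtype.val_injective) c
    exact ⟨v, funext hv⟩
  have hker : LinearMap.ker T = hJsub G J := by
    rw [LinearMap.ker_pi, iInf_subtype, hJsub]
  have h := LinearMap.finrank_range_add_finrank_ker T
  rwa [hT, finrank_top, Module.finrank_fintype_fun_eq_card, hker, add_comm] at h

theorem linearIndependent_root_hJsub (G : KacMoodyAlgebra A g) (J : Set I) :
    LinearIndependent ℂ fun k : {k : I // k ∉ J} => (G.root k.1).comp (hJsub G J).subtype := by
  have := G.findimH
  rw [Fintype.linearIndependent_iff]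
  intro c hc k
  obtain ⟨v, hv⟩ := exists_apply_eq G.indepRoot fun i => if i = k.1 then 1 else 0
  have hvJ : v ∈ hJsub G J := mem_hJsub.2 fun j hj => by
    rw [hv, if_neg]
    rintro rfl
    exact k.2 hj
  have h := LinearMap.congr_fun hc ⟨v, hvJ⟩
  simpa [hv, ← Subtype.ext_iff] using h

namespace CAdmissibleData

variable (D : CAdmissibleData G J)

theorem exists_Hc_eq (hGCM : IsGCM A) (k : {k : I // k ∉ J}) :
    ∃ a : ℂ, a ≠ 0 ∧ D.Hc k - a • G.coroot k.1 ∈ Submodule.span ℂ (G.coroot '' J) := by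
  have hS : cmpnt A (J ∪ {k.1}) k.1 ⊆ insert k.1 J := fun i hi => hi.1.symm
  have h := Submodule.span_mono (R := ℂ) (Set.image_mono hS) (D.isHGen k).1
  rw [Set.image_insert_eq, Submodule.mem_span_insert] at h
  obtain ⟨a, z, hz, h⟩ := h
  refine ⟨a, ?_, by rwa [h, add_sub_cancel_left]⟩
  rintro rfl
  rw [zero_smul, zero_add] at h
  have h0 : D.Hc k = 0 := Submodule.disjoint_def.1 (disjoint_span_coroot_hJsub hGCM D.finJ) _
    (h ▸ hz) (D.Hc_mem_hJsub k)
  have h2 := (D.isHGen k).2 k.1 (self_mem_cmpnt A J k.1)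
  simp [h0] at h2

theorem linearIndependent_Hc (hGCM : IsGCM A) : LinearIndependent ℂ D.Hc := by
  choose a ha h using D.exists_Hc_eq hGCM
  set Q := Submodule.span ℂ (G.coroot '' J) with hQ
  have h1 : LinearIndependent ℂ fun k : {k : I // k ∉ J} => Q.mkQ (G.coroot k.1) := by
    refine (G.indepCoroot.comp _ Subtype.val_injective).map ?_
    rw [Submodule.ker_mkQ, Set.range_comp, Subtype.range_coe_subtype]
    exact G.indepCoroot.disjoint_span_image (Set.disjoint_left.2 fun _ h => h)
  refine LinearIndependent.of_comp Q.mkQ ?_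
  convert h1.units_smul fun k => Units.mk0 (a k) (ha k) using 1
  funext k
  have := (Submodule.Quotient.eq Q).2 (h k)
  simpa [Units.smul_def] using this

theorem span_coroot_inf_hJsub (hGCM : IsGCM A) :
    Submodule.span ℂ (Set.range G.coroot) ⊓ hJsub G J = Submodule.span ℂ (Set.range D.Hc) := by
  have hHc : Submodule.span ℂ (Set.range D.Hc) ≤ hJsub G J :=
    Submodule.span_le.2 (Set.range_subset_iff.2 D.Hc_mem_hJsub)
  refine le_antisymm ?_ (le_inf (Submodule.span_le.2 (Set.range_subset_iff.2 fun k =>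
    Submodule.span_mono (Set.image_subset_range _ _) (D.isHGen k).1)) hHc)
  have hle : Submodule.span ℂ (Set.range G.coroot) ≤
      Submodule.span ℂ (G.coroot '' J) ⊔ Submodule.span ℂ (Set.range D.Hc) := by
    refine Submodule.span_le.2 (Set.range_subset_iff.2 fun i => ?_)
    by_cases hi : i ∈ J
    · exact Submodule.mem_sup_left (Submodule.subset_span ⟨i, hi, rfl⟩)
    · obtain ⟨a, ha, h⟩ := D.exists_Hc_eq hGCM ⟨i, hi⟩
      refine (Submodule.smul_mem_iff _ ha).1 ?_
      rw [← sub_sub_self (D.Hc ⟨i, hi⟩) (a • G.coroot i)]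
      exact sub_mem (Submodule.mem_sup_right (Submodule.subset_span ⟨_, rfl⟩))
        (Submodule.mem_sup_left h)
  refine (inf_le_inf_right _ hle).trans ?_
  rw [sup_comm, sup_inf_assoc_of_le _ hHc, (disjoint_span_coroot_hJsub hGCM D.finJ).eq_bot,
    sup_bot_eq]

theorem gcmCorank_eq (hGCM : IsGCM A) {A' : Matrix {k : I // k ∉ J} {k : I // k ∉ J} ℤ}
    (hA' : ∀ k l, (A' k l : ℂ) = G.root l.1 (D.Hc k)) : gcmCorank A' = gcmCorank A := by
  rw [gcmCorank_eq_finrank A G.indepCoroot G.pairing,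
    gcmCorank_eq_finrank A' (D.linearIndependent_Hc hGCM) (φ := fun k => G.root k.1)
      fun k l => (hA' k l).symm]
  have h : ⨅ i, LinearMap.ker (G.root i) =
      hJsub G J ⊓ ⨅ k : {k : I // k ∉ J}, LinearMap.ker (G.root k.1) := by
    rw [hJsub, iInf_subtype, ← iInf_inf_eq]
    refine iInf_congr fun i => ?_
    by_cases hi : i ∈ J <;> simp [hi]
  rw [h, ← inf_assoc, D.span_coroot_inf_hJsub hGCM]

theorem finrank_hJsub (hGCM : IsGCM A) {A' : Matrix {k : I // k ∉ J} {k : I // k ∉ J} ℤ}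
    (hA' : ∀ k l, (A' k l : ℂ) = G.root l.1 (D.Hc k)) :
    Module.finrank ℂ (hJsub G J) = Fintype.card {k : I // k ∉ J} + gcmCorank A' := by
  have h1 := finrank_hJsub_add_card G J
  have h2 : Fintype.card {k : I // k ∉ J} + Fintype.card J = Fintype.card I := by
    rw [add_comm, ← Fintype.card_sum]
    exact Fintype.card_congr (Equiv.sumCompl (· ∈ J))
  rw [G.finrankH, ← D.gcmCorank_eq hGCM hA'] at h1
  omega

end CAdmissibleData

end Cartan

/-! ### The Kac-Moody structure on `g^J` -/

section Assoc

open LieAlgebra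

theorem coe_ad_pow_apply {L : Type*} [LieRing L] [LieAlgebra ℂ L] (L' : LieSubalgebra ℂ L)
    (x y : L') (n : ℕ) :
    ((((ad ℂ L' x) ^ n) y : L') : L) = ((ad ℂ L (x : L)) ^ n) (y : L) := by
  induction n with
  | zero => rfl
  | succ n ih => rw [pow_succ', pow_succ', Module.End.mul_apply, Module.End.mul_apply, ← ih]; rfl

namespace CAdmissibleData

variable {I : Type*} [Fintype I] [DecidableEq I] {A : Matrix I I ℤ}
variable {g : Type*} [LieRing g] [LieAlgebra ℂ g] {G : KacMoodyAlgebra A g} {J : Set I}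
variable (D : CAdmissibleData G J)

theorem E_mem_gJ (k : {k : I // k ∉ J}) : D.E k ∈ D.gJ :=
  LieSubalgebra.subset_lieSpan (Or.inl (Or.inr ⟨k, rfl⟩))

theorem F_mem_gJ (k : {k : I // k ∉ J}) : D.F k ∈ D.gJ :=
  LieSubalgebra.subset_lieSpan (Or.inr ⟨k, rfl⟩)

/-- The inclusion of `h^J` in `g^J`. -/
def inclHJ : hJsub G J →ₗ[ℂ] D.gJ :=
  LinearMap.codRestrict D.gJ.toSubmodule (G.H.subtype ∘ₗ (hJsub G J).subtype) fun h =>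
    LieSubalgebra.subset_lieSpan (Or.inl (Or.inl ⟨h.1, h.2, rfl⟩))

theorem inclHJ_injective : Function.Injective D.inclHJ := fun _ _ h =>
  Subtype.ext (Subtype.ext (congrArg (fun x : D.gJ => (x : g)) h))

/-- `h^J`, as a subspace of `g^J`. -/
def cartanJ : Submodule ℂ D.gJ := LinearMap.range D.inclHJ

/-- The identification of `h^J` with its copy in `g^J`. -/
def equivCartanJ : hJsub G J ≃ₗ[ℂ] D.cartanJ := LinearEquiv.ofInjective _ D.inclHJ_injective

theorem coe_eq_equivCartanJ_symm (x : D.cartanJ) :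
    (((D.equivCartanJ.symm x : hJsub G J) : G.H) : g) = ((x : D.gJ) : g) := by
  conv_rhs => rw [← D.equivCartanJ.apply_symm_apply x]
  rfl

/-- The restriction of the simple root `α_k` to `h^J`. -/
def rootJ (k : {k : I // k ∉ J}) : Module.Dual ℂ D.cartanJ :=
  ((G.root k.1).comp (hJsub G J).subtype).comp D.equivCartanJ.symm.toLinearMap

theorem linearIndependent_rootJ : LinearIndependent ℂ D.rootJ :=
  (linearIndependent_root_hJsub G J).map' D.equivCartanJ.symm.dualMap.toLinearMap
    (LinearEquiv.ker _)

/-- The coroot `H_k`, as an element of the Cartan subalgebra of `g^J`. -/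
def corootJ (k : {k : I // k ∉ J}) : D.cartanJ := D.equivCartanJ ⟨D.Hc k, D.Hc_mem_hJsub k⟩

/-- The element `E_k` of `g^J`. -/
def eJ (k : {k : I // k ∉ J}) : D.gJ := ⟨D.E k, D.E_mem_gJ k⟩

/-- The element `F_k` of `g^J`. -/
def fJ (k : {k : I // k ∉ J}) : D.gJ := ⟨D.F k, D.F_mem_gJ k⟩

theorem linearIndependent_corootJ (hGCM : IsGCM A) : LinearIndependent ℂ D.corootJ := by
  have h : LinearIndependent ℂ fun k : {k : I // k ∉ J} =>
      (⟨D.Hc k, D.Hc_mem_hJsub k⟩ : hJsub G J) :=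
    LinearIndependent.of_comp (hJsub G J).subtype (D.linearIndependent_Hc hGCM)
  exact h.map' D.equivCartanJ.toLinearMap (LinearEquiv.ker _)

theorem lie_cartanJ (x y : D.cartanJ) : ⁅(x : D.gJ), (y : D.gJ)⁆ = 0 := by
  refine Subtype.ext ?_
  rw [LieSubalgebra.coe_bracket, ← coe_eq_equivCartanJ_symm, ← coe_eq_equivCartanJ_symm,
    G.abelian]
  rfl

theorem lie_cartanJ_eJ (x : D.cartanJ) (k : {k : I // k ∉ J}) :
    ⁅(x : D.gJ), D.eJ k⁆ = D.rootJ k x • D.eJ k := by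
  refine Subtype.ext ?_
  rw [LieSubalgebra.coe_bracket, ← coe_eq_equivCartanJ_symm]
  exact D.lie_hJ_E (D.equivCartanJ.symm x).2 k

theorem lie_cartanJ_fJ (x : D.cartanJ) (k : {k : I // k ∉ J}) :
    ⁅(x : D.gJ), D.fJ k⁆ = -(D.rootJ k x) • D.fJ k := by
  refine Subtype.ext ?_
  rw [LieSubalgebra.coe_bracket, ← coe_eq_equivCartanJ_symm]
  exact D.lie_hJ_F (D.equivCartanJ.symm x).2 k

theorem lie_eJ_fJ (k l : {k : I // k ∉ J}) :
    ⁅D.eJ k, D.fJ l⁆ = if l = k then ((D.corootJ k : D.gJ)) else 0 := by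
  refine Subtype.ext ?_
  rw [LieSubalgebra.coe_bracket]
  split_ifs with h
  · subst h
    exact (D.sl2 l).lie_e_f
  · exact D.lie_E_F_of_ne (Ne.symm h)

theorem lieSpan_cartanJ :
    LieSubalgebra.lieSpan ℂ D.gJ ((D.cartanJ : Set D.gJ) ∪ Set.range D.eJ ∪ Set.range D.fJ) =
      ⊤ := by
  have h : (D.cartanJ : Set D.gJ) ∪ Set.range D.eJ ∪ Set.range D.fJ = ((↑) : D.gJ → g) ⁻¹'
      ((((hJsub G J).map G.H.subtype : Submodule ℂ g) : Set g) ∪ Set.range D.E ∪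
        Set.range D.F) := by
    refine congrArg₂ _ (congrArg₂ _ ?_ ?_) ?_
    · ext x
      constructor
      · rintro ⟨h, rfl⟩
        exact ⟨h.1, h.2, rfl⟩
      · rintro ⟨h, hh, hx⟩
        exact ⟨⟨h, hh⟩, Subtype.ext hx⟩
    · ext x
      exact exists_congr fun k => Subtype.ext_iff
    · ext x
      exact exists_congr fun k => Subtype.ext_iff
  rw [h]
  exact LieSubalgebra.lieSpan_lieSpan_coe_preimage

theorem finiteDimensional_cartanJ : FiniteDimensional ℂ D.cartanJ := by
  have := G.findimH
  exact D.equivCartanJ.finiteDimensional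

/-- The Kac-Moody structure on `g^J`. -/
def kacMoodyJ (hGCM : IsGCM A) {A' : Matrix {k : I // k ∉ J} {k : I // k ∉ J} ℤ}
    (hA' : ∀ k l, (A' k l : ℂ) = G.root l.1 (D.Hc k)) : KacMoodyAlgebra A' ↥D.gJ where
  H := D.cartanJ
  root := D.rootJ
  coroot := D.corootJ
  e := D.eJ
  f := D.fJ
  findimH := D.finiteDimensional_cartanJ
  finrankH := by rw [← D.finrank_hJsub hGCM hA', D.equivCartanJ.finrank_eq]
  indepRoot := D.linearIndependent_rootJ
  indepCoroot := D.linearIndependent_corootJ hGCM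
  pairing k l := by simp [rootJ, corootJ, hA']
  abelian := D.lie_cartanJ
  lie_e := D.lie_cartanJ_eJ
  lie_f := D.lie_cartanJ_fJ
  e_f := D.lie_eJ_fJ
  serre_e k l h := Subtype.ext ((coe_ad_pow_apply ..).trans (D.serre_E hA' h))
  serre_f k l h := Subtype.ext ((coe_ad_pow_apply ..).trans (D.serre_F hA' h))
  generates := D.lieSpan_cartanJ
  weight_decomp := iSup_wtSpaceι_eq_top D.lie_cartanJ D.lie_cartanJ_eJ D.lie_cartanJ_fJ
    D.lieSpan_cartanJ
  zero_weight := by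
    have := D.finiteDimensional_cartanJ
    refine wtSpaceι_zero_eq D.linearIndependent_rootJ D.lie_cartanJ D.lie_cartanJ_eJ
      D.lie_cartanJ_fJ (fun k l => ?_) D.lieSpan_cartanJ
    rw [D.lie_eJ_fJ]
    split_ifs
    · exact (D.corootJ k).2
    · exact zero_mem _

theorem isAssocKM_kacMoodyJ (hGCM : IsGCM A) {A' : Matrix {k : I // k ∉ J} {k : I // k ∉ J} ℤ}
    (hA' : ∀ k l, (A' k l : ℂ) = G.root l.1 (D.Hc k)) :
    D.IsAssocKM (D.kacMoodyJ hGCM hA') := by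
  refine ⟨hA', ?_, fun _ => rfl, fun _ => rfl, fun _ => rfl⟩
  ext x
  constructor
  · rintro ⟨_, ⟨h, rfl⟩, rfl⟩
    exact ⟨h, h.2, rfl⟩
  · rintro ⟨h, hh, rfl⟩
    exact ⟨_, ⟨⟨h, hh⟩, rfl⟩, rfl⟩

end CAdmissibleData

end Assoc

end KMG


open KMG

section Statement

attribute [local instance] Classical.propDecidable

variable {I : Type*} [Fintype I] [DecidableEq I] {A : Matrix I I ℤ}
variable {g : Type*} [LieRing g] [LieAlgebra ℂ g]

theorem statement1
    (hGCM : IsGCM A) (hInd : Indecomposable A) (hSym : Symmetrizable A)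
    (G : KacMoodyAlgebra A g) (J : Set I) (D : CAdmissibleData G J)
    (A' : Matrix {k : I // k ∉ J} {k : I // k ∉ J} ℤ)
    (hA' : ∀ k l, (A' k l : ℂ) = G.root l.1 (D.Hc k)) :
    (∀ k l : {k : I // k ∉ J}, k ≠ l →
        ((LieAlgebra.ad ℂ g (D.E k)) ^ (1 - A' k l).toNat) (D.E l) = 0 ∧
        ((LieAlgebra.ad ℂ g (D.F k)) ^ (1 - A' k l).toNat) (D.F l) = 0) ∧
    ∃ GJ : KacMoodyAlgebra A' ↥D.gJ, D.IsAssocKM GJ := by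
  exact ⟨fun k l h => ⟨D.serre_E hA' h, D.serre_F hA' h⟩, D.kacMoodyJ hGCM hA',
    D.isAssocKM_kacMoodyJ hGCM hA'⟩

end Statement
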